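/- arXiv:1103.3843 — 2 statements merged into one kernel-verified Lean document; each statement's English description precedes it below -/
import Mathlib

section
/- (Luukkainen–Saksman) Let (X,d) be a nonempty, complete, doubling metric space with doubling constant D₁. Then X carries a doubling measure: there exist a Borel measure μ on X and a constant D ≥ 1 such that 0 < μ(B[x,r]) < ∞ for every x ∈ X and r > 0, and μ(B[x,2r]) ≤ D·μ(B[x,r]) for every x ∈ X and r > 0. -/
open MeasureTheory Metric

/-- `(X,d)` is a doubling metric space with constant `D₁`: every closed ball of radius `r`
can be covered by at most `D₁` closed balls of radius `r/2`. -/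
def MetricDoubling (X : Type*) [MetricSpace X] (D₁ : ℕ) : Prop :=
  ∀ (x : X) (r : ℝ), 0 < r →
    ∃ s : Finset X, s.card ≤ D₁ ∧
      closedBall x r ⊆ ⋃ y ∈ s, closedBall y (r / 2)


open Set Filter Topology
open scoped ENNReal

section Cov
variable {X : Type*} [MetricSpace X] {D₁ : ℕ}

lemma md_cover (hX : MetricDoubling X D₁) (j : ℕ) (x : X) {r : ℝ} (hr : 0 < r) :
    ∃ s : Finset X, s.card ≤ D₁ ^ j ∧ closedBall x r ⊆ ⋃ y ∈ s, closedBall y (r / 2 ^ j) := by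
  classical
  induction j with
  | zero => exact ⟨{x}, by simp, by simp⟩
  | succ j ih =>
    obtain ⟨s, hs, hc⟩ := ih
    choose f hf1 hf2 using fun y : X => hX y (r / 2 ^ j) (by positivity)
    refine ⟨s.biUnion f, ?_, ?_⟩
    · calc (s.biUnion f).card ≤ s.card * D₁ := Finset.card_biUnion_le_card_mul _ _ _ (fun y _ => hf1 y)
        _ ≤ D₁ ^ j * D₁ := Nat.mul_le_mul_right _ hs
        _ = D₁ ^ (j + 1) := (pow_succ _ _).symm
    · intro z hz
      have := hc hz
      simp only [mem_iUnion, exists_prop] at this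
      obtain ⟨y, hy, hzy⟩ := this
      have := hf2 y hzy
      simp only [mem_iUnion, exists_prop] at this
      obtain ⟨u, hu, hzu⟩ := this
      simp only [mem_iUnion, exists_prop]
      refine ⟨u, Finset.mem_biUnion.2 ⟨y, hy, hu⟩, ?_⟩
      rw [pow_succ, ← div_div]
      exact hzu

lemma md_sep (hX : MetricDoubling X D₁) (j : ℕ) (x : X) {r t : ℝ} (hr : 0 < r)
    (S : Set X) (hS : S ⊆ closedBall x r) (hsep : ∀ a ∈ S, ∀ b ∈ S, a ≠ b → t ≤ dist a b)
    (ht : 2 * (r / 2 ^ j) < t) : S.Finite ∧ S.ncard ≤ D₁ ^ j := by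
  obtain ⟨s, hs, hc⟩ := md_cover hX j x hr
  have h : ∀ a ∈ S, ∃ y ∈ s, dist a y ≤ r / 2 ^ j := by
    intro a ha
    have := hc (hS ha)
    simpa only [mem_iUnion, exists_prop, mem_closedBall] using this
  choose! f hf1 hf2 using h
  have hinj : InjOn f S := by
    intro a ha b hb hab
    by_contra hne
    have h1 := hsep a ha b hb hne
    have h2 := hf2 a ha
    have h3 := hf2 b hb
    rw [← hab] at h3
    have := dist_triangle_right a b (f a)
    linarith
  have hmaps : MapsTo f S (s : Set X) := fun a ha => hf1 a ha
  refine ⟨Finite.of_finite_image (s.finite_toSet.subset hmaps.image_subset) hinj, ?_⟩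
  have := ncard_le_ncard_of_injOn f hmaps hinj s.finite_toSet
  rw [ncard_coe_finset] at this
  exact this.trans hs

lemma md_proper [CompleteSpace X] (hX : MetricDoubling X D₁) : ProperSpace X := by
  refine ⟨fun x r => ?_⟩
  rcases le_or_gt r 0 with hr | hr
  · rcases hr.lt_or_eq with h | h
    · rw [closedBall_eq_empty.2 h]; exact isCompact_empty
    · rw [h, closedBall_zero]; exact isCompact_singleton
  refine TotallyBounded.isCompact_of_isClosed ?_ isClosed_closedBall
  rw [Metric.totallyBounded_iff]
  intro ε hε
  obtain ⟨j, hj⟩ := exists_pow_lt_of_lt_one (show 0 < ε / r by positivity) (show (1/2:ℝ) < 1 by norm_num)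
  obtain ⟨s, hs, hc⟩ := md_cover hX j x hr
  refine ⟨s, s.finite_toSet, hc.trans ?_⟩
  simp only [Finset.mem_coe]
  refine iUnion₂_mono fun y _ => closedBall_subset_ball ?_
  rw [lt_div_iff₀ hr] at hj
  rw [one_div, inv_pow] at hj
  rw [div_eq_inv_mul]; exact hj

lemma exists_net {t : ℝ} (ht : 0 < t) : ∃ S : Set X, (∀ a ∈ S, ∀ b ∈ S, a ≠ b → t ≤ dist a b) ∧
    ∀ x, ∃ y ∈ S, dist x y ≤ t := by
  obtain ⟨S, hS⟩ := zorn_subset {S : Set X | ∀ a ∈ S, ∀ b ∈ S, a ≠ b → t ≤ dist a b} (by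
    intro c hc hchain
    refine ⟨⋃₀ c, ?_, fun s hs => subset_sUnion_of_mem hs⟩
    rintro a ⟨s, hs, ha⟩ b ⟨s', hs', hb⟩ hne
    rcases hchain.total hs hs' with h | h
    · exact hc hs' a (h ha) b hb hne
    · exact hc hs a ha b (h hb) hne)
  refine ⟨S, hS.prop, fun x => ?_⟩
  by_contra! hcon
  have hmem : insert x S ∈ {S : Set X | ∀ a ∈ S, ∀ b ∈ S, a ≠ b → t ≤ dist a b} := by
    rintro a (rfl | ha) b (rfl | hb) hne
    · exact absurd rfl hne
    · exact (hcon b hb).le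
    · rw [dist_comm]; exact (hcon a ha).le
    · exact hS.prop a ha b hb hne
  have := hS.le_of_ge hmem (subset_insert x S) (mem_insert x S)
  have := hcon x this
  rw [dist_self] at this
  linarith

end Cov

structure NetSys (X : Type*) [MetricSpace X] (ρ : ℕ → ℝ) where
  N : ℕ → Set X
  pr : ℕ → X → X
  sep : ∀ k, ∀ a ∈ N k, ∀ b ∈ N k, a ≠ b → ρ k ≤ dist a b
  mem : ∀ k x, pr k x ∈ N k
  dist_le : ∀ k x, dist x (pr k x) ≤ ρ k
  near : ∀ k x, ∀ z ∈ N k, dist x z < ρ k / 2 → pr k x = z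

lemma exists_netSys (X : Type*) [MetricSpace X] (ρ : ℕ → ℝ) (hρ : ∀ k, 0 < ρ k) :
    Nonempty (NetSys X ρ) := by
  choose N hN1 hN2 using fun k => exists_net (X := X) (hρ k)
  have : ∀ k x, ∃ y ∈ N k, dist x y ≤ ρ k ∧ ∀ z ∈ N k, dist x z < ρ k / 2 → y = z := by
    intro k x
    by_cases h : ∃ z ∈ N k, dist x z < ρ k / 2
    · obtain ⟨z, hz, hd⟩ := h
      refine ⟨z, hz, by have := hρ k; linarith, fun z' hz' hd' => ?_⟩
      by_contra hne
      have := hN1 k z hz z' hz' hne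
      have := dist_triangle_left z z' x
      linarith
    · push Not at h
      obtain ⟨y, hy, hd⟩ := hN2 k x
      exact ⟨y, hy, hd, fun z hz hd' => absurd hd' (not_lt.2 (h z hz))⟩
  choose pr h1 h2 h3 using this
  exact ⟨⟨N, pr, hN1, h1, h2, h3⟩⟩

namespace NetSys
variable {X : Type*} [MetricSpace X] {ρ : ℕ → ℝ} (S : NetSys X ρ)

/-- children of `x` (level `k`) -/
def ch (k : ℕ) (x : X) : Set X := {y | y ∈ S.N (k + 1) ∧ S.pr k y = x}

open Classical in
noncomputable def fac (p : ℝ) (k : ℕ) (y : X) : ℝ :=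
  if y = S.pr (k + 1) (S.pr k y) then 1 - ((S.ch k (S.pr k y)).ncard - 1) * p else p

noncomputable def w (p : ℝ) : ℕ → X → ℝ≥0∞
  | 0, _ => 1
  | k + 1, y => w p k (S.pr k y) * ENNReal.ofReal (S.fac p k y)

noncomputable def m (p : ℝ) (k : ℕ) (A : Set X) : ℝ≥0∞ :=
  ∑' y : X, (S.N k ∩ A).indicator (S.w p k) y

variable {D₁ : ℕ} (hX : MetricDoubling X D₁) (hρ : ∀ k, 0 < ρ k)
  (hρ' : ∀ k, ρ (k + 1) = ρ k / 32) {p : ℝ} (hp : 0 < p) (hpD : 2 * (D₁ ^ 7 : ℕ) * p = 1)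

include hX hρ hρ' in
lemma ch_fin (k : ℕ) (x : X) : (S.ch k x).Finite ∧ (S.ch k x).ncard ≤ D₁ ^ 7 := by
  refine md_sep hX 7 x (hρ k) (t := ρ (k + 1)) _ ?_ ?_ ?_
  · rintro y ⟨hy, rfl⟩
    exact S.dist_le k y
  · rintro a ⟨ha, -⟩ b ⟨hb, -⟩ hne
    exact S.sep _ a ha b hb hne
  · rw [hρ']; have := hρ k; norm_num; linarith

include hρ hρ' in
lemma pr_pr (k : ℕ) {x : X} (hx : x ∈ S.N k) : S.pr k (S.pr (k + 1) x) = x := by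
  refine S.near k _ x hx ?_
  have := S.dist_le (k + 1) x
  rw [dist_comm, hρ'] at this
  have := hρ k
  linarith

include hρ hρ' in
lemma central_mem (k : ℕ) {x : X} (hx : x ∈ S.N k) : S.pr (k + 1) x ∈ S.ch k x :=
  ⟨S.mem _ _, S.pr_pr hρ hρ' k hx⟩

include hX hρ hρ' hp hpD in
lemma fac_bounds (k : ℕ) (y : X) : p ≤ S.fac p k y ∧ S.fac p k y ≤ 1 := by
  have h1 := S.ch_fin hX hρ hρ' k (S.pr k y)
  have h2 : 0 < (S.ch k (S.pr k y)).ncard :=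
    (ncard_pos h1.1).2 ⟨_, S.central_mem hρ hρ' k (S.mem k y)⟩
  have h3 : ((S.ch k (S.pr k y)).ncard : ℝ) ≤ (D₁ ^ 7 : ℕ) := by exact_mod_cast h1.2
  have h4 : (1:ℝ) ≤ ((S.ch k (S.pr k y)).ncard : ℝ) := by exact_mod_cast h2
  have h5 : p ≤ 1 / 2 := by nlinarith
  unfold fac
  split_ifs
  · constructor <;> nlinarith
  · constructor <;> linarith

lemma w_ne_top (k : ℕ) (y : X) : S.w p k y ≠ ⊤ := by
  induction k generalizing y with
  | zero => simp [w]
  | succ k ih => exact ENNReal.mul_ne_top (ih _) ENNReal.ofReal_ne_top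

include hX hρ hρ' hp hpD in
lemma w_pos (k : ℕ) (y : X) : S.w p k y ≠ 0 := by
  induction k generalizing y with
  | zero => simp [w]
  | succ k ih =>
    refine mul_ne_zero (ih _) ?_
    have := (S.fac_bounds hX hρ hρ' hp hpD k y).1
    simp only [ne_eq, ENNReal.ofReal_eq_zero, not_le]; linarith

include hX hρ hρ' hp hpD in
lemma w_succ_ge (k : ℕ) (y : X) : ENNReal.ofReal p * S.w p k (S.pr k y) ≤ S.w p (k + 1) y := by
  rw [w, mul_comm]
  gcongr
  exact (S.fac_bounds hX hρ hρ' hp hpD k y).1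

include hX hρ hρ' hp hpD in
lemma w_succ_le (k : ℕ) (y : X) : S.w p (k + 1) y ≤ S.w p k (S.pr k y) := by
  rw [w]
  refine mul_le_of_le_one_right' ?_
  exact ENNReal.ofReal_le_one.2 (S.fac_bounds hX hρ hρ' hp hpD k y).2

include hX hρ hρ' hp hpD in
lemma w_comp (k : ℕ) (y y' : X) (hy : y ∈ S.N k) (hy' : y' ∈ S.N k) (hd : dist y y' ≤ 10 * ρ k) :
    ENNReal.ofReal p * S.w p k y' ≤ S.w p k y := by
  induction k generalizing y y' with
  | zero =>
    have hb := S.fac_bounds hX hρ hρ' hp hpD 0 y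
    simp only [w, mul_one]
    exact ENNReal.ofReal_le_one.2 (hb.1.trans hb.2)
  | succ k ih =>
    by_cases hu : S.pr k y = S.pr k y'
    · refine le_trans ?_ (S.w_succ_ge hX hρ hρ' hp hpD k y)
      rw [hu]
      gcongr
      exact S.w_succ_le hX hρ hρ' hp hpD k y'
    · have hk := hρ k
      have hk' := hρ' k
      have key : ∀ a b : X, dist a b ≤ 10 * ρ (k + 1) → S.pr k a ≠ S.pr k b → S.fac p k a = p := by
        intro a b hab hne
        unfold fac
        rw [if_neg]
        intro hc
        apply hne
        symm
        refine S.near k b _ (S.mem k a) ?_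
        have h1 := S.dist_le (k + 1) (S.pr k a)
        rw [← hc] at h1
        have := dist_triangle_left b (S.pr k a) a
        rw [dist_comm] at h1
        linarith
      have h1 := key y y' hd hu
      have h2 := key y' y (by rwa [dist_comm]) (Ne.symm hu)
      have h3 := ih (S.pr k y) (S.pr k y') (S.mem _ _) (S.mem _ _) (by
        have h1 := S.dist_le k y
        have h2 := S.dist_le k y'
        have := dist_triangle4 (S.pr k y) y y' (S.pr k y')
        rw [dist_comm] at h1
        linarith)
      rw [w, w, h1, h2, ← mul_assoc]
      gcongr

include hX hρ hρ' hp hpD in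
lemma sum_fac (k : ℕ) {x : X} (hx : x ∈ S.N k) :
    ∑' y : X, (S.ch k x).indicator (fun y => ENNReal.ofReal (S.fac p k y)) y = 1 := by
  classical
  have hfin := (S.ch_fin hX hρ hρ' k x).1
  have hc := S.central_mem hρ hρ' k hx
  rw [tsum_eq_sum (s := hfin.toFinset) (by
    intro y hy; rw [indicator_of_notMem]; simpa using hy)]
  rw [Finset.sum_congr rfl (g := fun y => ENNReal.ofReal (S.fac p k y)) (by
    intro y hy; rw [indicator_of_mem]; simpa using hy)]
  rw [← ENNReal.ofReal_sum_of_nonneg (by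
    intro y _; exact hp.le.trans (S.fac_bounds hX hρ hρ' hp hpD k y).1)]
  rw [← Finset.add_sum_erase _ _ (hfin.mem_toFinset.2 hc)]
  have h1 : S.fac p k (S.pr (k + 1) x) = 1 - ((S.ch k x).ncard - 1) * p := by
    unfold fac
    rw [S.pr_pr hρ hρ' k hx, if_pos rfl]
  rw [Finset.sum_congr rfl (g := fun y => p) (by
    intro y hy
    rw [Finset.mem_erase, hfin.mem_toFinset] at hy
    obtain ⟨hne, hy1, hy2⟩ := hy
    unfold fac
    rw [hy2, if_neg hne])]
  rw [h1, Finset.sum_const, Finset.card_erase_of_mem (hfin.mem_toFinset.2 hc),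
    ← ncard_eq_toFinset_card _ hfin, nsmul_eq_mul]
  have h2 : 0 < (S.ch k x).ncard := (ncard_pos hfin).2 ⟨_, hc⟩
  rw [Nat.cast_sub h2]
  simp

include hX hρ hρ' hp hpD in
lemma m_succ (k : ℕ) (A : Set X) : S.m p k A = S.m p (k + 1) (S.pr k ⁻¹' A) := by
  unfold m
  rw [← ENNReal.tsum_fiberwise ((S.N (k + 1) ∩ S.pr k ⁻¹' A).indicator (S.w p (k + 1))) (S.pr k)]
  refine tsum_congr fun x => ?_
  rw [tsum_subtype (S.pr k ⁻¹' {x}) (fun y => (S.N (k + 1) ∩ S.pr k ⁻¹' A).indicator (S.w p (k + 1)) y)]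
  by_cases hx : x ∈ S.N k ∩ A
  · rw [indicator_of_mem hx]
    rw [← mul_one (S.w p k x), ← S.sum_fac hX hρ hρ' hp hpD k hx.1, ← ENNReal.tsum_mul_left]
    refine tsum_congr fun y => ?_
    by_cases hy : y ∈ S.ch k x
    · obtain ⟨hy1, hy2⟩ := id hy
      rw [indicator_of_mem hy, indicator_of_mem (by exact hy2), indicator_of_mem
        (show y ∈ S.N (k + 1) ∩ S.pr k ⁻¹' A from ⟨hy1, by rw [mem_preimage, hy2]; exact hx.2⟩), w, hy2]
    · rw [indicator_of_notMem hy, mul_zero]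
      by_cases h2 : S.pr k y = x
      · rw [indicator_of_mem (by exact h2), indicator_of_notMem]
        rintro ⟨h3, -⟩
        exact hy ⟨h3, h2⟩
      · rw [indicator_of_notMem (by exact h2)]
  · rw [indicator_of_notMem hx]
    symm
    rw [ENNReal.tsum_eq_zero]
    intro y
    by_cases h2 : S.pr k y = x
    · rw [indicator_of_mem (by exact h2), indicator_of_notMem]
      rintro ⟨h3, h4⟩
      rw [mem_preimage, h2] at h4
      exact hx ⟨h2 ▸ S.mem k y, h4⟩
    · rw [indicator_of_notMem (by exact h2)]

lemma m_mono (k : ℕ) {A B : Set X} (h : A ⊆ B) : S.m p k A ≤ S.m p k B := by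
  refine ENNReal.tsum_le_tsum fun y => ?_
  exact indicator_le_indicator_of_subset (inter_subset_inter_right _ h) (fun _ => zero_le) y

include hX hρ hρ' hp hpD in
lemma m_up (n i : ℕ) (x : X) (R : ℝ) :
    S.m p (i + n) (closedBall x R) ≤ S.m p i (closedBall x (R + 2 * ρ i)) := by
  induction n generalizing i with
  | zero => exact S.m_mono _ (closedBall_subset_closedBall (by have := hρ i; linarith))
  | succ n ih =>
    have := ih (i + 1)
    rw [show i + 1 + n = i + (n + 1) by ring] at this
    refine this.trans ?_
    rw [S.m_succ hX hρ hρ' hp hpD i]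
    refine S.m_mono _ fun y hy => ?_
    have h1 := S.dist_le i y
    rw [mem_closedBall] at hy
    rw [mem_preimage, mem_closedBall]
    have := dist_triangle_left (S.pr i y) x y
    have := hρ i
    rw [hρ'] at hy
    linarith

include hX hρ hρ' hp hpD in
lemma m_down (n i : ℕ) (x : X) (R : ℝ) :
    S.m p i (closedBall x R) ≤ S.m p (i + n) (closedBall x (R + 2 * ρ i)) := by
  induction n generalizing i R with
  | zero => exact S.m_mono _ (closedBall_subset_closedBall (by have := hρ i; linarith))
  | succ n ih =>
    rw [S.m_succ hX hρ hρ' hp hpD i]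
    refine le_trans (S.m_mono _ (B := closedBall x (R + ρ i)) fun y hy => ?_) ?_
    · have h1 := S.dist_le i y
      rw [mem_preimage, mem_closedBall] at hy
      rw [mem_closedBall]
      have := dist_triangle y (S.pr i y) x
      linarith
    · have := ih (i + 1) (R + ρ i)
      rw [show i + 1 + n = i + (n + 1) by ring] at this
      refine this.trans (S.m_mono _ (closedBall_subset_closedBall ?_))
      have := hρ i
      rw [hρ']
      linarith

lemma m_ge (k : ℕ) {A : Set X} {y : X} (hy : y ∈ S.N k) (hA : y ∈ A) : S.w p k y ≤ S.m p k A := by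
  have := ENNReal.le_tsum (f := (S.N k ∩ A).indicator (S.w p k)) y
  rwa [indicator_of_mem (show y ∈ S.N k ∩ A from ⟨hy, hA⟩)] at this

include hX hρ in
lemma m_le (k : ℕ) (x : X) (R : ℝ) (hR : R ≤ 8 * ρ k) (c : ℝ≥0∞)
    (hc : ∀ y ∈ S.N k ∩ closedBall x R, S.w p k y ≤ c) :
    S.m p k (closedBall x R) ≤ (D₁ ^ 7 : ℕ) * c := by
  classical
  have hk := hρ k
  obtain ⟨hfin, hcard⟩ := md_sep hX 7 x (r := 8 * ρ k) (t := ρ k) (by linarith)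
    (S.N k ∩ closedBall x R)
    (inter_subset_right.trans (closedBall_subset_closedBall hR))
    (fun a ha b hb => S.sep k a ha.1 b hb.1) (by norm_num; linarith)
  unfold m
  rw [tsum_eq_sum (s := hfin.toFinset) (by
    intro y hy; rw [indicator_of_notMem]; simpa using hy)]
  calc _ ≤ ∑ y ∈ hfin.toFinset, c := by
        refine Finset.sum_le_sum fun y hy => ?_
        rw [hfin.mem_toFinset] at hy
        rw [indicator_of_mem hy]; exact hc y hy
    _ = (S.N k ∩ closedBall x R).ncard * c := by
        rw [Finset.sum_const, ← ncard_eq_toFinset_card _ hfin, nsmul_eq_mul]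
    _ ≤ _ := by gcongr

include hX hρ in
lemma m_fin (k : ℕ) (x : X) (R : ℝ) : S.m p k (closedBall x R) ≠ ⊤ := by
  classical
  have hk := hρ k
  set r := max R 1 with hr
  have hr0 : 0 < r := by positivity
  obtain ⟨j, hj⟩ := exists_pow_lt_of_lt_one (show 0 < ρ k / (2 * r) by positivity) (show (1/2:ℝ) < 1 by norm_num)
  obtain ⟨hfin, -⟩ := md_sep hX j x (r := r) (t := ρ k) hr0
    (S.N k ∩ closedBall x R)
    (inter_subset_right.trans (closedBall_subset_closedBall (le_max_left _ _)))
    (fun a ha b hb => S.sep k a ha.1 b hb.1) (by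
      rw [lt_div_iff₀ (by positivity), one_div, inv_pow] at hj
      calc 2 * (r / 2 ^ j) = (2 ^ j)⁻¹ * (2 * r) := by ring
        _ < _ := hj)
  unfold m
  rw [tsum_eq_sum (s := hfin.toFinset) (by
    intro y hy; rw [indicator_of_notMem]; simpa using hy)]
  refine (ENNReal.sum_lt_top.2 fun y hy => ?_).ne
  rw [hfin.mem_toFinset] at hy
  rw [indicator_of_mem hy]
  exact (S.w_ne_top k y).lt_top

include hX hρ hρ' hp hpD in
/-- doubling at scale between -/
lemma m_doubling (n i : ℕ) (x : X) (R : ℝ) (h1 : 3 * ρ (i + 1) ≤ R) (h2 : R ≤ 3 * ρ i) :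
    S.m p (i + 1 + n) (closedBall x (2 * R)) ≤
      (D₁ ^ 7 : ℕ) * (ENNReal.ofReal p⁻¹) ^ 3 * S.m p (i + 1 + n) (closedBall x R) ∧
    S.m p (i + 1 + n) (closedBall x R) ≠ 0 := by
  have hk := hρ i
  have hk1 := hρ' i
  have hdi := S.dist_le i x
  have hdj := S.dist_le (i + 1) x
  have hinv : ∀ a b : ℝ≥0∞, ENNReal.ofReal p * a ≤ b → a ≤ ENNReal.ofReal p⁻¹ * b := by
    intro a b h
    calc a = ENNReal.ofReal p⁻¹ * (ENNReal.ofReal p * a) := by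
          rw [← mul_assoc, ← ENNReal.ofReal_mul (by positivity), inv_mul_cancel₀ hp.ne']; simp
      _ ≤ _ := by gcongr
  have low : S.w p (i + 1) (S.pr (i + 1) x) ≤ S.m p (i + 1 + n) (closedBall x R) := by
    refine le_trans (S.m_ge (i + 1) (A := closedBall x (ρ (i + 1))) (S.mem _ _) (by
      rw [mem_closedBall, dist_comm]; exact hdj)) ?_
    refine (S.m_down hX hρ hρ' hp hpD n (i + 1) x _).trans (S.m_mono _ ?_)
    exact closedBall_subset_closedBall (by linarith)
  refine ⟨?_, fun h => ?_⟩
  · have up : S.m p (i + 1 + n) (closedBall x (2 * R)) ≤ S.m p i (closedBall x (8 * ρ i)) := by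
      have := S.m_up hX hρ hρ' hp hpD (n + 1) i x (2 * R)
      rw [show i + (n + 1) = i + 1 + n by ring] at this
      refine this.trans (S.m_mono _ (closedBall_subset_closedBall (by linarith)))
    refine up.trans ?_
    rw [mul_assoc]
    refine S.m_le hX hρ i x _ le_rfl _ fun y hy => ?_
    have hy2 := mem_closedBall.1 hy.2
    have a1 : S.w p i y ≤ ENNReal.ofReal p⁻¹ * S.w p i (S.pr i x) := by
      refine hinv _ _ (S.w_comp hX hρ hρ' hp hpD i _ _ (S.mem _ _) hy.1 ?_)
      have := dist_triangle_left (S.pr i x) y x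
      rw [dist_comm x y] at this
      linarith
    have a2 : S.w p i (S.pr i x) ≤ ENNReal.ofReal p⁻¹ * S.w p i (S.pr i (S.pr (i + 1) x)) := by
      refine hinv _ _ (S.w_comp hX hρ hρ' hp hpD i _ _ (S.mem _ _) (S.mem _ _) ?_)
      have b1 := S.dist_le i (S.pr (i + 1) x)
      have b2 := dist_triangle4 (S.pr i x) x (S.pr (i + 1) x) (S.pr i (S.pr (i + 1) x))
      rw [dist_comm _ x] at b2
      rw [dist_comm]
      linarith
    have a3 := hinv _ _ (S.w_succ_ge hX hρ hρ' hp hpD i (S.pr (i + 1) x))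
    calc _ ≤ _ := a1
      _ ≤ ENNReal.ofReal p⁻¹ * (ENNReal.ofReal p⁻¹ * (ENNReal.ofReal p⁻¹ *
          S.m p (i + 1 + n) (closedBall x R))) := by
          gcongr
          refine a2.trans ?_
          gcongr
          refine a3.trans ?_
          gcongr
      _ = _ := by ring
  · rw [h] at low
    exact S.w_pos hX hρ hρ' hp hpD _ _ (le_antisymm low zero_le)

end NetSys

lemma exists_approx {X : Type*} [MetricSpace X] [Nonempty X] [MeasurableSpace X] [BorelSpace X]
    {D₁ : ℕ} (hX : MetricDoubling X D₁) : ∃ C : ℝ, 1 ≤ C ∧ ∀ n : ℕ, ∃ ν : Measure X,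
      (∀ x R, ν (closedBall x R) ≠ ⊤) ∧ ∀ x R, 1 / ((n : ℝ) + 1) ≤ R → R ≤ n + 1 →
        ν (closedBall x R) ≠ 0 ∧
        ν (closedBall x (2 * R)) ≤ ENNReal.ofReal C * ν (closedBall x R) := by
  have hD : 1 ≤ D₁ := by
    by_contra h
    obtain ⟨s, hs, hc⟩ := hX (Classical.arbitrary X) 1 one_pos
    have hs0 : s = ∅ := Finset.card_eq_zero.1 (by omega)
    have := hc (mem_closedBall_self zero_le_one)
    simp [hs0] at this
  have hM1 : (1:ℝ) ≤ ((D₁ ^ 7 : ℕ) : ℝ) := by exact_mod_cast Nat.one_le_pow _ _ hD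
  set M : ℝ := ((D₁ ^ 7 : ℕ) : ℝ) with hM
  set p : ℝ := (2 * M)⁻¹ with hpdef
  have hp : 0 < p := by positivity
  have hpD : 2 * ((D₁ ^ 7 : ℕ) : ℝ) * p = 1 := by
    rw [← hM, hpdef]; exact mul_inv_cancel₀ (by positivity)
  have hpinv : p⁻¹ = 2 * M := by rw [hpdef, inv_inv]
  refine ⟨M * p⁻¹ ^ 3, ?_, fun n => ?_⟩
  · rw [hpinv]
    exact one_le_mul_of_one_le_of_one_le hM1 (one_le_pow₀ (by linarith))
  set ρ : ℕ → ℝ := fun k => ((n : ℝ) + 1) / 32 ^ k with hρd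
  have hρ : ∀ k, 0 < ρ k := fun k => by simp only [hρd]; positivity
  have hρ' : ∀ k, ρ (k + 1) = ρ k / 32 := fun k => by
    simp only [hρd]; rw [pow_succ, div_div]
  obtain ⟨S⟩ := exists_netSys X ρ hρ
  obtain ⟨K, hK⟩ : ∃ K, 3 * ρ K ≤ 1 / ((n : ℝ) + 1) := by
    obtain ⟨K, hK⟩ := exists_pow_lt_of_lt_one
      (show 0 < 1 / ((n : ℝ) + 1) / (3 * (n + 1)) by positivity) (show (1/32:ℝ) < 1 by norm_num)
    refine ⟨K, ?_⟩
    rw [lt_div_iff₀ (by positivity), one_div, inv_pow] at hK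
    simp only [hρd]
    calc 3 * (((n : ℝ) + 1) / 32 ^ K) = (32 ^ K)⁻¹ * (3 * (n + 1)) := by ring
      _ ≤ _ := hK.le
  set ν : Measure X := Measure.sum (fun y : S.N K => S.w p K y • Measure.dirac (y : X)) with hν
  have hνm : ∀ x R, ν (closedBall x R) = S.m p K (closedBall x R) := by
    intro x R
    have hmeas : MeasurableSet (closedBall x R) := isClosed_closedBall.measurableSet
    rw [hν, Measure.sum_apply _ hmeas]
    unfold NetSys.m
    rw [← indicator_indicator, ← tsum_subtype]
    refine tsum_congr fun y => ?_
    rw [Measure.smul_apply, Measure.dirac_apply' _ hmeas, smul_eq_mul]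
    by_cases hy : (y : X) ∈ closedBall x R
    · rw [indicator_of_mem hy, indicator_of_mem hy]; simp
    · rw [indicator_of_notMem hy, indicator_of_notMem hy]; simp
  refine ⟨ν, fun x R => by rw [hνm]; exact S.m_fin hX hρ K x R, fun x R h1 h2 => ?_⟩
  have hex : ∃ j, 3 * ρ j ≤ R := ⟨K, hK.trans h1⟩
  classical
  have hj := Nat.find_spec hex
  have hjK : Nat.find hex ≤ K := Nat.find_min' hex (hK.trans h1)
  rcases hjd : Nat.find hex with _ | i
  · rw [hjd] at hj
    simp only [hρd, pow_zero, div_one] at hj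
    have : (0:ℝ) ≤ n := n.cast_nonneg
    linarith
  · rw [hjd] at hj hjK
    have hi := Nat.find_min hex (m := i) (by omega)
    obtain ⟨l, rfl⟩ := Nat.exists_eq_add_of_le hjK
    have := S.m_doubling hX hρ hρ' hp hpD l i x R hj (not_le.1 hi).le
    rw [hνm, hνm]
    refine ⟨this.2, this.1.trans_eq ?_⟩
    congr 1
    rw [ENNReal.ofReal_mul (by positivity), ENNReal.ofReal_pow (by positivity), hM,
      ENNReal.ofReal_natCast]

section Limit
open scoped CompactlySupported
variable {X : Type*} [MetricSpace X] [ProperSpace X]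

lemma exists_cutoff (x : X) {R : ℝ} (hR : 0 < R) : ∃ f : C_c(X, ℝ), (∀ y, 0 ≤ f y) ∧ (∀ y, f y ≤ 1) ∧
    (∀ y ∈ closedBall x R, f y = 1) ∧ ∀ y ∉ closedBall x (2 * R), f y = 0 := by
  have h0 : ∀ y ∉ closedBall x (2 * R), max 0 (min 1 (2 - dist y x / R)) = 0 := by
    intro y hy
    rw [mem_closedBall, not_le] at hy
    refine max_eq_left ((min_le_right _ _).trans ?_)
    have := (lt_div_iff₀ hR).2 hy
    linarith
  refine ⟨⟨⟨fun y => max 0 (min 1 (2 - dist y x / R)), by fun_prop⟩,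
    HasCompactSupport.intro (isCompact_closedBall x (2 * R)) h0⟩, fun y => le_max_left _ _,
    fun y => max_le zero_le_one (min_le_left _ _), fun y hy => ?_, h0⟩
  change max 0 (min 1 (2 - dist y x / R)) = 1
  have : dist y x / R ≤ 1 := (div_le_one hR).2 hy
  rw [min_eq_left (by linarith), max_eq_right zero_le_one]

variable [MeasurableSpace X] [BorelSpace X]

lemma cc_integrable (ν : Measure X) [IsFiniteMeasureOnCompacts ν] (f : C_c(X, ℝ)) :
    Integrable (fun y => f y) ν :=
  f.continuous.integrable_of_hasCompactSupport f.hasCompactSupport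

lemma cutoff_bounds (ν : Measure X) [IsFiniteMeasureOnCompacts ν] {x : X} {R : ℝ}
    {f : C_c(X, ℝ)} (f0 : ∀ y, 0 ≤ f y) (f1 : ∀ y, f y ≤ 1)
    (f2 : ∀ y ∈ closedBall x R, f y = 1) (f3 : ∀ y ∉ closedBall x (2 * R), f y = 0) :
    ν.real (closedBall x R) ≤ ∫ y, f y ∂ν ∧ ∫ y, f y ∂ν ≤ ν.real (closedBall x (2 * R)) := by
  have hm : ∀ r, MeasurableSet (closedBall x r) := fun r => isClosed_closedBall.measurableSet
  have hfin : ∀ r, ν (closedBall x r) ≠ ⊤ := fun r => (isCompact_closedBall x r).measure_ne_top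
  have hi : ∀ r, Integrable ((closedBall x r).indicator (1 : X → ℝ)) ν := fun r =>
    (integrable_indicator_iff (hm r)).2 (integrableOn_const (hfin r))
  constructor
  · rw [← integral_indicator_one (hm R)]
    refine integral_mono (hi R) (cc_integrable ν f) fun y => ?_
    by_cases hy : y ∈ closedBall x R
    · simp [indicator_of_mem hy, f2 y hy]
    · simp [indicator_of_notMem hy, f0 y]
  · rw [← integral_indicator_one (hm (2 * R))]
    refine integral_mono (cc_integrable ν f) (hi _) fun y => ?_
    by_cases hy : y ∈ closedBall x (2 * R)
    · simp [indicator_of_mem hy, f1 y]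
    · simp [indicator_of_notMem hy, f3 y hy]

lemma limit_measure (ν : ℕ → Measure X) [∀ n, IsFiniteMeasureOnCompacts (ν n)]
    (U : Ultrafilter ℕ)
    (hb : ∀ (x : X) (R : ℝ), 0 < R → ∃ B : ℝ, ∀ᶠ n in (U : Filter ℕ), (ν n).real (closedBall x R) ≤ B)
    (x₀ : X) :
    ∃ μ : Measure X, IsFiniteMeasureOnCompacts μ ∧
      ∀ f : C_c(X, ℝ), Tendsto (fun n => ∫ y, f y ∂(ν n)) U (𝓝 (∫ y, f y ∂μ)) := by
  have hlim : ∀ f : C_c(X, ℝ), ∃ l : ℝ, Tendsto (fun n => ∫ y, f y ∂(ν n)) U (𝓝 l) := by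
    intro f
    obtain ⟨c, hc⟩ := f.hasCompactSupport.exists_bound_of_continuous f.continuous
    obtain ⟨r, hr0, hr⟩ := (f.hasCompactSupport.isCompact.isBounded).subset_closedBall_lt 0 x₀
    obtain ⟨B, hB⟩ := hb x₀ r hr0
    have hc0 : 0 ≤ c := (norm_nonneg _).trans (hc x₀)
    have hev : ∀ᶠ n in (U : Filter ℕ), ∫ y, f y ∂(ν n) ∈ Icc (-(c * B)) (c * B) := by
      filter_upwards [hB] with n hn
      have h1 : ∫ y, f y ∂(ν n) = ∫ y in closedBall x₀ r, f y ∂(ν n) := by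
        symm
        refine setIntegral_eq_integral_of_forall_compl_eq_zero fun y hy => ?_
        exact image_eq_zero_of_notMem_tsupport fun h => hy (hr h)
      have h2 : ‖∫ y in closedBall x₀ r, f y ∂(ν n)‖ ≤ c * (ν n).real (closedBall x₀ r) :=
        norm_setIntegral_le_of_norm_le_const (isCompact_closedBall x₀ r).measure_lt_top
          (fun y _ => hc y)
      rw [← h1] at h2
      exact abs_le.1 (h2.trans (by gcongr))
    obtain ⟨l, -, hl⟩ := isCompact_Icc.ultrafilter_le_nhds (U.map fun n => ∫ y, f y ∂(ν n))
      (le_principal_iff.2 hev)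
    exact ⟨l, hl⟩
  choose L hL using hlim
  let Λ₀ : C_c(X, ℝ) →ₗ[ℝ] ℝ :=
    { toFun := L
      map_add' := by
        intro f g
        refine tendsto_nhds_unique (hL (f + g)) (((hL f).add (hL g)).congr fun n => ?_)
        rw [← integral_add (cc_integrable _ f) (cc_integrable _ g)]
        rfl
      map_smul' := by
        intro c f
        refine tendsto_nhds_unique (hL (c • f)) (((hL f).const_mul c).congr fun n => ?_)
        rw [← integral_const_mul]
        rfl }
  let Λ : C_c(X, ℝ) →ₚ[ℝ] ℝ := PositiveLinearMap.mk₀ Λ₀ (by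
    intro f hf
    refine ge_of_tendsto' (hL f) fun n => integral_nonneg fun y => hf y)
  refine ⟨RealRMK.rieszMeasure Λ, inferInstance, fun f => ?_⟩
  rw [RealRMK.integral_rieszMeasure]
  exact hL f

end Limit

theorem stmt14 {X : Type*} [MetricSpace X] [Nonempty X] [CompleteSpace X]
    [MeasurableSpace X] [BorelSpace X]
    (D₁ : ℕ) (hX : MetricDoubling X D₁) :
    ∃ (μ : Measure X) (D : ℝ), 1 ≤ D ∧
      (∀ (x : X) (r : ℝ), 0 < r → 0 < μ (closedBall x r) ∧ μ (closedBall x r) < ⊤) ∧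
      ∀ (x : X) (r : ℝ), 0 < r →
        μ (closedBall x (2 * r)) ≤ ENNReal.ofReal D * μ (closedBall x r) := by
  haveI := md_proper hX
  obtain ⟨C, hC, h⟩ := exists_approx hX
  choose ν₀ hfin₀ hd₀ using h
  have hC0 : 0 ≤ C := by linarith
  let x₀ : X := Classical.arbitrary X
  have hne : ∀ n, ν₀ n (closedBall x₀ 1) ≠ 0 := by
    intro n
    have hn : (0:ℝ) ≤ n := n.cast_nonneg
    exact (hd₀ n x₀ 1 (by rw [div_le_one (by positivity)]; linarith) (by linarith)).1
  let ν : ℕ → Measure X := fun n => (ν₀ n (closedBall x₀ 1))⁻¹ • ν₀ n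
  have hfin : ∀ n x R, ν n (closedBall x R) ≠ ⊤ := fun n x R => by
    simp only [ν, Measure.smul_apply, smul_eq_mul]
    exact ENNReal.mul_ne_top (ENNReal.inv_ne_top.2 (hne n)) (hfin₀ n x R)
  have hone : ∀ n, (ν n).real (closedBall x₀ 1) = 1 := fun n => by
    simp only [ν, Measure.real, Measure.smul_apply, smul_eq_mul]
    rw [ENNReal.inv_mul_cancel (hne n) (hfin₀ n x₀ 1), ENNReal.toReal_one]
  have hd : ∀ (n : ℕ) (x : X) (R : ℝ), 1 / ((n : ℝ) + 1) ≤ R → R ≤ n + 1 →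
      (ν n).real (closedBall x (2 * R)) ≤ C * (ν n).real (closedBall x R) := by
    intro n x R h1 h2
    have : ν n (closedBall x (2 * R)) ≤ ENNReal.ofReal C * ν n (closedBall x R) := by
      simp only [ν, Measure.smul_apply, smul_eq_mul]
      rw [mul_left_comm]
      gcongr
      exact (hd₀ n x R h1 h2).2
    have := ENNReal.toReal_mono (ENNReal.mul_ne_top ENNReal.ofReal_ne_top (hfin n x R)) this
    rwa [ENNReal.toReal_mul, ENNReal.toReal_ofReal hC0] at this
  haveI : ∀ n, IsFiniteMeasureOnCompacts (ν n) := fun n => ⟨fun K hK => by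
    obtain ⟨r, hr⟩ := hK.isBounded.subset_closedBall x₀
    exact (measure_mono hr).trans_lt (hfin n x₀ r).lt_top⟩
  have hmono : ∀ n (x y : X) (r s : ℝ), closedBall x r ⊆ closedBall y s →
      (ν n).real (closedBall x r) ≤ (ν n).real (closedBall y s) := fun n x y r s h =>
    measureReal_mono h (hfin n y s)
  have hev : ∀ (j : ℕ) (x : X) (R : ℝ), 0 < R → ∀ᶠ n : ℕ in atTop,
      (ν n).real (closedBall x (2 ^ j * R)) ≤ C ^ j * (ν n).real (closedBall x R) := by
    intro j x R hR
    induction j with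
    | zero => simp
    | succ j ih =>
      have hp : 0 < 2 ^ j * R := by positivity
      have e1 : ∀ᶠ n : ℕ in atTop, 1 / ((n : ℝ) + 1) ≤ 2 ^ j * R :=
        (tendsto_one_div_add_atTop_nhds_zero_nat.eventually_lt_const hp).mono fun n hn => hn.le
      have e2 : ∀ᶠ n : ℕ in atTop, 2 ^ j * R ≤ (n : ℝ) :=
        tendsto_natCast_atTop_atTop.eventually_ge_atTop _
      filter_upwards [ih, e1, e2] with n h1 h2 h3
      have := hd n x _ h2 (by linarith)
      rw [pow_succ', mul_assoc, pow_succ' C, mul_assoc]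
      exact this.trans (mul_le_mul_of_nonneg_left h1 hC0)
  let U : Ultrafilter ℕ := hyperfilter ℕ
  have hU : (U : Filter ℕ) ≤ atTop := Nat.hyperfilter_le_atTop
  have hpow : ∀ t : ℝ, ∃ j : ℕ, t ≤ 2 ^ j := fun t =>
    (pow_unbounded_of_one_lt t one_lt_two).imp fun _ h => h.le
  obtain ⟨μ, hμ, hlim⟩ := limit_measure ν U (by
    intro x R hR
    obtain ⟨j, hj⟩ := hpow (R + dist x x₀)
    refine ⟨C ^ j, ?_⟩
    filter_upwards [hU (hev j x₀ 1 one_pos)] with n hn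
    rw [hone, mul_one, mul_one] at hn
    exact (hmono n _ _ _ _ (closedBall_subset_closedBall' hj)).trans hn) x₀
  have hμfin : ∀ x r, μ (closedBall x r) ≠ ⊤ := fun x r =>
    (isCompact_closedBall x r).measure_ne_top
  have lower : ∀ (x : X) (r : ℝ), 0 < r → 0 < μ.real (closedBall x r) := by
    intro x r hr
    obtain ⟨f, f0, f1, f2, f3⟩ := exists_cutoff x (half_pos hr)
    obtain ⟨j, hj⟩ := hpow ((1 + dist x₀ x) / (r / 2))
    rw [div_le_iff₀ (half_pos hr)] at hj
    have hb := (cutoff_bounds μ f0 f1 f2 f3).2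
    rw [show 2 * (r / 2) = r by ring] at hb
    refine lt_of_lt_of_le (?_ : 0 < (C ^ j)⁻¹) (le_trans ?_ hb)
    · have : 0 < C := by linarith
      positivity
    refine ge_of_tendsto (hlim f) ?_
    filter_upwards [hU (hev j x (r / 2) (half_pos hr))] with n hn
    refine le_trans ?_ (cutoff_bounds (ν n) f0 f1 f2 f3).1
    have h1 := hmono n x₀ x 1 _ (closedBall_subset_closedBall' hj)
    rw [hone] at h1
    rw [inv_le_iff_one_le_mul₀ (by have : 0 < C := by linarith
                                   positivity), mul_comm]
    exact h1.trans hn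
  refine ⟨μ, C ^ 3, one_le_pow₀ hC, fun x r hr => ⟨?_, (hμfin x r).lt_top⟩, fun x r hr => ?_⟩
  · exact (ENNReal.toReal_pos_iff.1 (lower x r hr)).1
  · obtain ⟨f, f0, f1, f2, f3⟩ := exists_cutoff x (half_pos hr)
    obtain ⟨g, g0, g1, g2, g3⟩ := exists_cutoff x (show 0 < 2 * r by positivity)
    have a1 := (cutoff_bounds μ g0 g1 g2 g3).1
    have a2 := (cutoff_bounds μ f0 f1 f2 f3).2
    rw [show 2 * (r / 2) = r by ring] at a2
    have a3 : ∫ y, g y ∂μ ≤ C ^ 3 * ∫ y, f y ∂μ := by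
      refine le_of_tendsto_of_tendsto (hlim g) ((hlim f).const_mul _) ?_
      filter_upwards [hU (hev 3 x (r / 2) (half_pos hr))] with n hn
      have b1 := (cutoff_bounds (ν n) g0 g1 g2 g3).2
      have b2 := (cutoff_bounds (ν n) f0 f1 f2 f3).1
      rw [show 2 * (2 * r) = 2 ^ 3 * (r / 2) by ring] at b1
      exact (b1.trans hn).trans (by gcongr)
    have a4 : μ.real (closedBall x (2 * r)) ≤ C ^ 3 * μ.real (closedBall x r) :=
      (a1.trans a3).trans (by gcongr)
    rw [← ofReal_measureReal (hμfin x (2 * r)), ← ofReal_measureReal (hμfin x r),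
      ← ENNReal.ofReal_mul (by positivity)]
    exact ENNReal.ofReal_le_ofReal a4
end

section
/- Let (X,d) be a nonempty, complete, doubling metric space (with doubling constant D₁) containing at least two points, which is uniformly perfect with constant C ≥ 1. Then (X,d) is quasisymmetrically equivalent to an Ahlfors regular space: there exist α > 0, a metric ρ on X, a Borel measure μ on (X,ρ), and a constant C₀ ≥ 1 such that (X,ρ,μ) is Ahlfors α-regular with constant C₀, and there exists a homeomorphism η : [0,∞) → [0,∞) such that the identity map from (X,d) to (X,ρ) is η-quasisymmetric, i.e. ρ(x,a)/ρ(x,b) ≤ η(d(x,a)/d(x,b)) for all triples of distinct points x, a, b ∈ X. -/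
open MeasureTheory Metric

/-- `(X,d)` is uniformly perfect with constant `C`. -/
def UniformlyPerfect (X : Type*) [MetricSpace X] (C : ℝ) : Prop :=
  ∀ (x : X) (r : ℝ), 0 < r → ENNReal.ofReal r ≤ EMetric.diam (Set.univ : Set X) →
    ∃ y : X, r / C ≤ dist x y ∧ dist x y ≤ r

/-- A metric, given as a distance function. -/
def IsMetricFun {X : Type*} (d : X → X → ℝ) : Prop :=
  (∀ x y, 0 ≤ d x y) ∧ (∀ x y, d x y = 0 ↔ x = y) ∧ (∀ x y, d x y = d y x) ∧
    ∀ x y z, d x y ≤ d x z + d z y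

namespace QSA

theorem cover_pow {X : Type*} [MetricSpace X] {D : ℕ} (h : MetricDoubling X D) (k : ℕ) :
    ∀ (x : X) (r : ℝ), 0 < r → ∃ s : Finset X, s.card ≤ D ^ k ∧
      closedBall x r ⊆ ⋃ y ∈ s, closedBall y (r / 2 ^ k) := by
  classical
  induction k with
  | zero =>
    intro x r hr
    exact ⟨{x}, by simp, by simp⟩
  | succ k ih =>
    intro x r hr
    obtain ⟨s, hs, hc⟩ := ih x r hr
    have hr' : 0 < r / 2 ^ k := by positivity
    choose t ht htc using fun y : X => h y (r / 2 ^ k) hr'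
    refine ⟨s.biUnion t, ?_, ?_⟩
    · refine Finset.card_biUnion_le.trans ?_
      refine (Finset.sum_le_sum (fun y _ => ht y)).trans ?_
      rw [Finset.sum_const, smul_eq_mul, pow_succ]
      exact Nat.mul_le_mul_right _ hs
    · intro z hz
      obtain ⟨y, hy, hzy⟩ := Set.mem_iUnion₂.1 (hc hz)
      obtain ⟨u, hu, hzu⟩ := Set.mem_iUnion₂.1 (htc y hzy)
      refine Set.mem_iUnion₂.2 ⟨u, Finset.mem_biUnion.2 ⟨y, hy, hu⟩, ?_⟩
      rw [pow_succ, ← div_div]; exact hzu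

theorem sep_card {X : Type*} [MetricSpace X] {D : ℕ} (h : MetricDoubling X D) (k : ℕ)
    (S : Set X) (ε : ℝ) (hS : ∀ x ∈ S, ∀ y ∈ S, x ≠ y → ε ≤ dist x y) (x : X) (r : ℝ) (hr : 0 < r)
    (hSr : S ⊆ closedBall x r) (hk : r * 2 < ε * 2 ^ k) : S.Finite ∧ S.ncard ≤ D ^ k := by
  classical
  obtain ⟨s, hs, hc⟩ := cover_pow h k x r hr
  have : ∀ y ∈ S, ∃ u ∈ s, dist y u ≤ r / 2 ^ k := by
    intro y hy
    obtain ⟨u, hu, hyu⟩ := Set.mem_iUnion₂.1 (hc (hSr hy))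
    exact ⟨u, hu, hyu⟩
  choose! f hf hfd using this
  have hinj : Set.InjOn f S := by
    intro y hy z hz hyz
    by_contra hne
    have h1 := hS y hy z hz hne
    have h2 := hfd y hy
    have h3 := hfd z hz
    rw [← hyz] at h3
    have h4 := dist_triangle_right y z (f y)
    have h5 : r / 2 ^ k + r / 2 ^ k < ε := by
      rw [← add_div, div_lt_iff₀ (by positivity)]; linarith
    linarith
  have hmap : Set.MapsTo f S (s : Set X) := fun y hy => hf y hy
  refine ⟨Set.Finite.of_injOn hmap hinj s.finite_toSet, ?_⟩
  refine (Set.ncard_le_ncard_of_injOn f hmap hinj s.finite_toSet).trans ?_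
  rw [Set.ncard_coe_finset]; exact hs

theorem proper {X : Type*} [MetricSpace X] [CompleteSpace X] {D : ℕ} (h : MetricDoubling X D) :
    ProperSpace X := by
  refine ⟨fun x r => ?_⟩
  rcases le_or_gt r 0 with hr | hr
  · rcases hr.lt_or_eq with hr | rfl
    · rw [closedBall_eq_empty.2 hr]; exact isCompact_empty
    · rw [closedBall_zero]; exact isCompact_singleton
  refine TotallyBounded.isCompact_of_isClosed ?_ isClosed_closedBall
  rw [Metric.totallyBounded_iff]
  intro ε hε
  obtain ⟨k, hk⟩ := pow_unbounded_of_one_lt (r / ε) (one_lt_two)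
  obtain ⟨s, hs, hc⟩ := cover_pow h k x r hr
  refine ⟨s, s.finite_toSet, hc.trans ?_⟩
  refine Set.iUnion₂_mono fun y _ => closedBall_subset_ball ?_
  rw [div_lt_iff₀ hε] at hk
  rw [div_lt_iff₀ (by positivity)]; linarith

theorem exists_net {X : Type*} [MetricSpace X] (ε : ℝ) (hε : 0 < ε) : ∃ (N : Set X) (P : X → X),
    (∀ x ∈ N, ∀ y ∈ N, x ≠ y → ε ≤ dist x y) ∧ (∀ y, P y ∈ N) ∧ (∀ y, dist y (P y) ≤ ε) ∧
    (∀ y, ∀ z ∈ N, dist y z ≤ ε / 4 → P y = z) := by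
  classical
  obtain ⟨N, hN⟩ := zorn_subset {N : Set X | ∀ x ∈ N, ∀ y ∈ N, x ≠ y → ε ≤ dist x y} (by
    intro c hc hch
    refine ⟨⋃₀ c, ?_, fun s hs => Set.subset_sUnion_of_mem hs⟩
    rintro x ⟨s, hs, hx⟩ y ⟨t, ht, hy⟩ hxy
    rcases hch.total hs ht with hst | hst
    · exact hc ht x (hst hx) y hy hxy
    · exact hc hs x hx y (hst hy) hxy)
  have hsep := hN.prop
  have hnear : ∀ y, ∃ z ∈ N, dist y z ≤ ε := by
    intro y
    by_contra! hcon
    have hy : insert y N ∈ {N : Set X | ∀ x ∈ N, ∀ y ∈ N, x ≠ y → ε ≤ dist x y} := by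
      rintro a (rfl | ha) b (rfl | hb) hab
      · exact absurd rfl hab
      · exact (hcon b hb).le
      · rw [dist_comm]; exact (hcon a ha).le
      · exact hsep a ha b hb hab
    have := hN.le_of_ge hy (Set.subset_insert y N)
    have h1 := hcon y (this (Set.mem_insert y N))
    rw [dist_self] at h1; linarith
  have hP : ∀ y, ∃ p ∈ N, dist y p ≤ ε ∧ ∀ z ∈ N, dist y z ≤ ε / 4 → p = z := by
    intro y
    by_cases h : ∃ z ∈ N, dist y z ≤ ε / 4
    · obtain ⟨p, hp, hd⟩ := h
      refine ⟨p, hp, by linarith, fun z hz hdz => ?_⟩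
      by_contra hne
      have := hsep p hp z hz hne
      have := dist_triangle_left p z y
      linarith
    · push Not at h
      obtain ⟨p, hp, hd⟩ := hnear y
      exact ⟨p, hp, hd, fun z hz hdz => absurd hdz (not_le.2 (h z hz))⟩
  choose P h1 h2 h3 using hP
  exact ⟨N, P, hsep, h1, h2, h3⟩

structure NetSys (X : Type*) [MetricSpace X] (M : ℕ) where
  s : ℕ → ℝ
  N : ℕ → Set X
  P : ℕ → X → X
  spos : ∀ j, 0 < s j
  ssucc : ∀ j, s (j + 1) = s j / 32
  sep : ∀ j, ∀ x ∈ N j, ∀ y ∈ N j, x ≠ y → s j ≤ dist x y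
  PN : ∀ j y, P j y ∈ N j
  Pd : ∀ j y, dist y (P j y) ≤ s j
  Pc : ∀ j y, ∀ z ∈ N j, dist y z ≤ s j / 4 → P j y = z
  Mpos : 0 < M
  fin : ∀ j x r, (N j ∩ closedBall x r).Finite
  card1 : ∀ j x, (N (j + 1) ∩ closedBall x (s j)).ncard ≤ M
  card4 : ∀ j x, (N j ∩ closedBall x (4 * s j)).ncard ≤ M

theorem exists_netSys {X : Type*} [MetricSpace X] [Nonempty X] {D : ℕ} (h : MetricDoubling X D)
    (S : ℝ) (hS : 0 < S) : ∃ A : NetSys X (D ^ 7), ∀ j, A.s j = S / 32 ^ j := by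
  choose N P h1 h2 h3 h4 using fun j : ℕ =>
    exists_net (X := X) (S / 32 ^ j) (by positivity)
  refine ⟨⟨fun j => S / 32 ^ j, N, P, fun j => by positivity, fun j => ?_, h1, h2, h3, h4, ?_, ?_, ?_, ?_⟩,
    fun j => rfl⟩
  · rw [pow_succ, div_div]
  · apply pow_pos
    rcases Nat.eq_zero_or_pos D with rfl | hD
    · obtain ⟨x⟩ := ‹Nonempty X›
      obtain ⟨s, hs, hc⟩ := h x 1 one_pos
      have : s = ∅ := by simpa using hs
      subst this
      have := hc (mem_closedBall_self zero_le_one)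
      simp at this
    · exact hD
  · intro j x r
    obtain ⟨k, hk⟩ := pow_unbounded_of_one_lt (max r 1 * 2 / (S / 32 ^ j)) (one_lt_two)
    refine (sep_card h k (N j ∩ closedBall x r) (S / 32 ^ j)
      (fun a ha b hb => h1 j a ha.1 b hb.1) x (max r 1) (by positivity)
      (Set.inter_subset_right.trans (closedBall_subset_closedBall (le_max_left _ _))) ?_).1
    rw [div_lt_iff₀ (by positivity)] at hk
    linarith
  · intro j x
    refine (sep_card h 7 _ (S / 32 ^ (j+1))
      (fun a ha b hb => h1 (j+1) a ha.1 b hb.1) x (S / 32 ^ j) (by positivity)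
      Set.inter_subset_right ?_).2
    have : 0 < S / 32 ^ j := by positivity
    rw [pow_succ, ← div_div]; linarith
  · intro j x
    refine (sep_card h 7 _ (S / 32 ^ j)
      (fun a ha b hb => h1 j a ha.1 b hb.1) x (4 * (S / 32 ^ j)) (by positivity)
      Set.inter_subset_right ?_).2
    have : 0 < S / 32 ^ j := by positivity
    linarith

namespace NetSys
variable {X : Type*} [MetricSpace X] {M : ℕ} (A : NetSys X M)

def kids (j : ℕ) (z : X) : Set X := {y | y ∈ A.N (j + 1) ∧ A.P j y = z}

open Classical in
noncomputable def w : ℕ → X → ℝ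
  | 0, _ => 1
  | j + 1, y => w j (A.P j y) *
      (if y = A.P (j + 1) (A.P j y) then 1 - (((A.kids j (A.P j y)).ncard : ℝ) - 1) / M else 1 / M)

theorem kids_sub (j : ℕ) (z : X) : A.kids j z ⊆ A.N (j + 1) ∩ closedBall z (A.s j) := by
  rintro y ⟨hy, rfl⟩
  exact ⟨hy, A.Pd j y⟩

theorem kids_fin (j : ℕ) (z : X) : (A.kids j z).Finite :=
  (A.fin (j + 1) z (A.s j)).subset (A.kids_sub j z)

theorem kids_card (j : ℕ) (z : X) : (A.kids j z).ncard ≤ M :=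
  (Set.ncard_le_ncard (A.kids_sub j z) (A.fin (j + 1) z (A.s j))).trans (A.card1 j z)

theorem central_mem (j : ℕ) {z : X} (hz : z ∈ A.N j) : A.P (j + 1) z ∈ A.kids j z := by
  refine ⟨A.PN _ _, A.Pc j _ z hz ?_⟩
  have h1 := A.Pd (j + 1) z
  have h2 := A.ssucc j
  have h3 := A.spos j
  rw [dist_comm]; linarith

theorem one_le_kids (j : ℕ) {z : X} (hz : z ∈ A.N j) : 1 ≤ (A.kids j z).ncard :=
  (Set.ncard_pos (A.kids_fin j z)).2 ⟨_, A.central_mem j hz⟩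

theorem Mr {X : Type*} [MetricSpace X] {M : ℕ} (A : NetSys X M) : (0 : ℝ) < M := Nat.cast_pos.2 A.Mpos

theorem central_bd (j : ℕ) {z : X} (hz : z ∈ A.N j) :
    1 / (M : ℝ) ≤ 1 - (((A.kids j z).ncard : ℝ) - 1) / M ∧
      1 - (((A.kids j z).ncard : ℝ) - 1) / M ≤ 1 := by
  have h1 : (1 : ℝ) ≤ (A.kids j z).ncard := by exact_mod_cast A.one_le_kids j hz
  have h2 : ((A.kids j z).ncard : ℝ) ≤ M := by exact_mod_cast A.kids_card j z
  have hM := A.Mr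
  constructor
  · rw [div_le_iff₀ hM, sub_mul, div_mul_cancel₀ _ hM.ne']; linarith
  · have : 0 ≤ (((A.kids j z).ncard : ℝ) - 1) / M := div_nonneg (by linarith) hM.le
    linarith

theorem w_pos (j : ℕ) : ∀ y, 0 < A.w j y := by
  induction j with
  | zero => intro y; exact one_pos
  | succ j ih =>
    intro y
    rw [w]
    have := (A.central_bd j (A.PN j y)).1
    have hM : 0 < 1 / (M : ℝ) := by have := A.Mr; positivity
    refine mul_pos (ih _) ?_
    split_ifs
    · linarith
    · exact hM

theorem w_succ_le (j : ℕ) (y : X) : A.w (j + 1) y ≤ A.w j (A.P j y) := by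
  rw [w]
  refine mul_le_of_le_one_right (A.w_pos _ _).le ?_
  split_ifs
  · exact (A.central_bd j (A.PN j y)).2
  · exact (A.central_bd j (A.PN j y)).1.trans (A.central_bd j (A.PN j y)).2

theorem le_w_succ (j : ℕ) (y : X) : A.w j (A.P j y) ≤ M * A.w (j + 1) y := by
  have hM := A.Mr
  have : A.w j (A.P j y) * (1 / M) ≤ A.w (j + 1) y := by
    rw [w]
    refine mul_le_mul_of_nonneg_left ?_ (A.w_pos _ _).le
    split_ifs
    · exact (A.central_bd j (A.PN j y)).1
    · exact le_rfl
  rw [mul_one_div, div_le_iff₀ hM] at this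
  linarith

theorem w_le_one (j : ℕ) : ∀ y, A.w j y ≤ 1 := by
  induction j with
  | zero => intro y; exact le_rfl
  | succ j ih => intro y; exact (A.w_succ_le j y).trans (ih _)

theorem neighbor (j : ℕ) : ∀ y ∈ A.N j, ∀ y' ∈ A.N j, dist y y' ≤ 4 * A.s j →
    A.w j y ≤ M * A.w j y' := by
  have hM1 : (1 : ℝ) ≤ M := by exact_mod_cast A.Mpos
  induction j with
  | zero =>
    intro y _ y' _ _
    simpa [w] using hM1
  | succ j ih =>
    intro y hy y' hy' hd
    have hs := A.ssucc j
    have hs0 := A.spos j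
    by_cases hP : A.P j y = A.P j y'
    · calc A.w (j + 1) y ≤ A.w j (A.P j y) := A.w_succ_le j y
        _ = A.w j (A.P j y') := by rw [hP]
        _ ≤ _ := A.le_w_succ j y'
    · have key : ∀ u v : X, dist u v ≤ 4 * A.s (j + 1) → A.P j u ≠ A.P j v →
          u ≠ A.P (j + 1) (A.P j u) := by
        intro u v huv hne hu
        apply hne
        have h1 := A.Pd (j + 1) (A.P j u)
        rw [← hu] at h1
        refine (A.Pc j v _ (A.PN j u) ?_).symm
        have := dist_triangle v u (A.P j u)
        rw [dist_comm v u, dist_comm u (A.P j u)] at this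
        linarith
      have c1 := key y y' hd hP
      have c2 := key y' y (by rwa [dist_comm]) (Ne.symm hP)
      rw [w, w, if_neg c1, if_neg c2]
      have h0 := ih (A.P j y) (A.PN j y) (A.P j y') (A.PN j y') (by
        have h1 := A.Pd j y
        have h2 := A.Pd j y'
        have h3 := dist_triangle4 (A.P j y) y y' (A.P j y')
        rw [dist_comm (A.P j y) y] at h3
        linarith)
      rw [← mul_assoc]
      exact mul_le_mul_of_nonneg_right h0 (by positivity)

open Classical in
/-- mass of a set at level j -/
noncomputable def F (j : ℕ) (T : Set X) : ENNReal :=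
  ∑' z : X, if z ∈ A.N j ∧ z ∈ T then ENNReal.ofReal (A.w j z) else 0

theorem F_mono (j : ℕ) {S T : Set X} (h : S ⊆ T) : A.F j S ≤ A.F j T := by
  classical
  refine ENNReal.tsum_le_tsum fun z => ?_
  split_ifs with h1 h2
  · exact le_rfl
  · exact absurd ⟨h1.1, h h1.2⟩ h2
  · exact zero_le
  · exact le_rfl

theorem sum_kids (j : ℕ) {z : X} (hz : z ∈ A.N j) :
    ∑ y ∈ (A.kids_fin j z).toFinset, A.w (j + 1) y = A.w j z := by
  classical
  have hM := A.Mr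
  have h1 : ∀ y ∈ (A.kids_fin j z).toFinset, A.w (j + 1) y = A.w j z * ((1 / M : ℝ) +
      if y = A.P (j + 1) z then 1 - ((A.kids j z).ncard : ℝ) / M else 0) := by
    intro y hy
    have hy' := (A.kids_fin j z).mem_toFinset.1 hy
    rw [w, hy'.2]
    split_ifs
    · ring
    · ring
  rw [Finset.sum_congr rfl h1, ← Finset.mul_sum, Finset.sum_add_distrib, Finset.sum_ite_eq',
    if_pos ((A.kids_fin j z).mem_toFinset.2 (A.central_mem j hz)), Finset.sum_const,
    ← Set.ncard_eq_toFinset_card _ (A.kids_fin j z)]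
  rw [nsmul_eq_mul]; ring

theorem F_preimage (j : ℕ) (T : Set X) : A.F (j + 1) (A.P j ⁻¹' T) = A.F j T := by
  classical
  have h1 : A.F (j + 1) (A.P j ⁻¹' T) = ∑' y : X, ∑' z : X, if z = A.P j y then
      (if y ∈ A.N (j + 1) ∧ y ∈ A.P j ⁻¹' T then ENNReal.ofReal (A.w (j + 1) y) else 0) else 0 := by
    unfold F
    refine tsum_congr fun y => ?_
    rw [tsum_ite_eq]
  rw [h1, ENNReal.tsum_comm]
  unfold F
  refine tsum_congr fun z => ?_
  split_ifs with hz
  · rw [tsum_eq_sum (s := (A.kids_fin j z).toFinset)]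
    · rw [← A.sum_kids j hz.1, ENNReal.ofReal_sum_of_nonneg (fun y _ => (A.w_pos _ _).le)]
      refine Finset.sum_congr rfl fun y hy => ?_
      have hy' := (A.kids_fin j z).mem_toFinset.1 hy
      rw [if_pos hy'.2.symm, if_pos ⟨hy'.1, by rw [Set.mem_preimage, hy'.2]; exact hz.2⟩]
    · intro y hy
      rw [Set.Finite.mem_toFinset] at hy
      split_ifs with h2 h3
      · exact absurd ⟨h3.1, h2.symm⟩ hy
      · rfl
      · rfl
  · rw [ENNReal.tsum_eq_zero]
    intro y
    split_ifs with h2 h3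
    · exact absurd ⟨h2 ▸ A.PN j y, h2 ▸ h3.2⟩ hz
    · rfl
    · rfl

theorem F_up (j : ℕ) (x : X) (r : ℝ) (k : ℕ) :
    A.F (j + k) (closedBall x r) ≤ A.F j (closedBall x (r + 2 * A.s j - 2 * A.s (j + k))) := by
  induction k generalizing r with
  | zero => simp
  | succ k ih =>
    have : A.F (j + k + 1) (closedBall x r) ≤ A.F (j + k) (closedBall x (r + A.s (j + k))) := by
      rw [← A.F_preimage (j + k)]
      refine A.F_mono _ fun y hy => ?_
      rw [mem_closedBall] at hy
      rw [Set.mem_preimage, mem_closedBall]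
      have := A.Pd (j + k) y
      have := dist_triangle (A.P (j + k) y) y x
      rw [dist_comm _ y] at this
      linarith
    refine this.trans ((ih _).trans (A.F_mono _ (closedBall_subset_closedBall ?_)))
    have h1 := A.ssucc (j + k)
    have h0 := A.spos (j + k)
    rw [← add_assoc]
    linarith

theorem F_down (j : ℕ) (x : X) (r : ℝ) (k : ℕ) :
    A.F j (closedBall x r) ≤ A.F (j + k) (closedBall x (r + 2 * A.s j - 2 * A.s (j + k))) := by
  induction k with
  | zero => simp
  | succ k ih =>
    refine ih.trans ?_
    rw [← A.F_preimage, ← add_assoc]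
    refine A.F_mono _ fun y hy => ?_
    rw [Set.mem_preimage, mem_closedBall] at hy
    rw [mem_closedBall]
    have h1 := A.ssucc (j + k)
    have h0 := A.spos (j + k)
    have := A.Pd (j + k) y
    have := dist_triangle y (A.P (j + k) y) x
    linarith

theorem le_F (j : ℕ) {T : Set X} {z : X} (hz : z ∈ A.N j) (hT : z ∈ T) :
    ENNReal.ofReal (A.w j z) ≤ A.F j T := by
  classical
  refine le_trans ?_ (ENNReal.le_tsum z)
  rw [if_pos ⟨hz, hT⟩]

theorem F_le (j : ℕ) (x : X) (r c : ℝ) (m : ℕ) (hm : (A.N j ∩ closedBall x r).ncard ≤ m)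
    (hc : ∀ z ∈ A.N j, z ∈ closedBall x r → A.w j z ≤ c) :
    A.F j (closedBall x r) ≤ m * ENNReal.ofReal c := by
  classical
  unfold F
  rw [tsum_eq_sum (s := (A.fin j x r).toFinset)]
  · refine (Finset.sum_le_card_nsmul _ _ (ENNReal.ofReal c) ?_).trans ?_
    · intro z hz
      rw [Set.Finite.mem_toFinset] at hz
      rw [if_pos ⟨hz.1, hz.2⟩]
      exact ENNReal.ofReal_le_ofReal (hc z hz.1 hz.2)
    · rw [nsmul_eq_mul, ← Set.ncard_eq_toFinset_card _ (A.fin j x r)]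
      gcongr
  · intro z hz
    rw [Set.Finite.mem_toFinset] at hz
    exact if_neg hz

theorem F_lt_top (j : ℕ) (x : X) (r : ℝ) : A.F j (closedBall x r) < ⊤ := by
  refine (A.F_le j x r 1 _ le_rfl (fun z _ _ => A.w_le_one j z)).trans_lt ?_
  exact ENNReal.mul_lt_top (by simp) (by simp)

theorem w_step (i : ℕ) (x : X) : A.w i (A.P i x) ≤ M ^ 2 * A.w (i + 1) (A.P (i + 1) x) := by
  have h1 := A.neighbor i (A.P i x) (A.PN i x) (A.P i (A.P (i + 1) x)) (A.PN _ _) (by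
    have h1 := A.Pd i x
    have h2 := A.Pd (i + 1) x
    have h3 := A.Pd i (A.P (i + 1) x)
    have h4 := dist_triangle4 (A.P i x) x (A.P (i + 1) x) (A.P i (A.P (i + 1) x))
    rw [dist_comm (A.P i x) x] at h4
    have := A.ssucc i
    have := A.spos i
    linarith)
  have h2 := A.le_w_succ i (A.P (i + 1) x)
  have hM := A.Mr
  calc _ ≤ _ := h1
    _ ≤ M * (M * A.w (i + 1) (A.P (i + 1) x)) := by gcongr
    _ = _ := by ring

theorem F_doubling (i k : ℕ) (x : X) (r : ℝ) (h1 : 2 * r ≤ A.s i) (h2 : A.s i ≤ 64 * r) :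
    A.F (i + 2 + k) (closedBall x (2 * r)) ≤ (M : ENNReal) ^ 6 * A.F (i + 2 + k) (closedBall x r) := by
  have s1 := A.ssucc i
  have s2 := A.ssucc (i + 1)
  have s0 := A.spos i
  have hM := A.Mr
  have u1 : A.F (i + 2 + k) (closedBall x (2 * r)) ≤ A.F i (closedBall (A.P i x) (4 * A.s i)) := by
    rw [add_assoc]
    refine (A.F_up i x (2 * r) (2 + k)).trans (A.F_mono _ (closedBall_subset_closedBall' ?_))
    have := A.spos (i + (2 + k))
    have := A.Pd i x
    linarith
  have u2 := A.F_le i (A.P i x) (4 * A.s i) (M * A.w i (A.P i x)) M (A.card4 i _)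
    (fun z hz hzd => A.neighbor i z hz _ (A.PN i x) hzd)
  have u3 : A.w i (A.P i x) ≤ M ^ 4 * A.w (i + 2) (A.P (i + 2) x) := by
    calc _ ≤ _ := A.w_step i x
      _ ≤ M ^ 2 * (M ^ 2 * A.w (i + 2) (A.P (i + 2) x)) := by
        gcongr; exact A.w_step (i + 1) x
      _ = _ := by ring
  have u4 : ENNReal.ofReal (A.w (i + 2) (A.P (i + 2) x)) ≤ A.F (i + 2 + k) (closedBall x r) := by
    refine (A.le_F (i + 2) (A.PN _ _) (T := closedBall x (A.s (i + 2))) ?_).trans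
      ((A.F_down (i + 2) x _ k).trans (A.F_mono _ (closedBall_subset_closedBall ?_)))
    · rw [mem_closedBall, dist_comm]; exact A.Pd _ _
    · have := A.spos (i + 2 + k)
      have : A.s (i + 2) = A.s (i + 1) / 32 := s2
      linarith
  calc _ ≤ _ := u1
    _ ≤ _ := u2
    _ ≤ M * ENNReal.ofReal (M * (M ^ 4 * A.w (i + 2) (A.P (i + 2) x))) := by gcongr
    _ = M ^ 6 * ENNReal.ofReal (A.w (i + 2) (A.P (i + 2) x)) := by
      rw [← mul_assoc, ENNReal.ofReal_mul (by positivity), ← mul_assoc, ← pow_succ',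
        ENNReal.ofReal_pow (by positivity), ENNReal.ofReal_natCast, ← pow_succ']
    _ ≤ _ := by gcongr

theorem F_pos (j : ℕ) (x : X) (r : ℝ) (h : A.s j ≤ r) : 0 < A.F j (closedBall x r) := by
  refine lt_of_lt_of_le (ENNReal.ofReal_pos.2 (A.w_pos j (A.P j x))) (A.le_F j (A.PN j x) ?_)
  rw [mem_closedBall, dist_comm]; exact (A.Pd j x).trans h

end NetSys

theorem stage {X : Type*} [MetricSpace X] [Nonempty X] [MeasurableSpace X] [BorelSpace X] {D : ℕ}
    (h : MetricDoubling X D) (n : ℕ) : ∃ m : Measure X,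
    (∀ x r, m (closedBall x r) < ⊤) ∧ (∀ x r, 1 / 32 ^ n ≤ r → 0 < m (closedBall x r)) ∧
    (∀ x r, 1 / 32 ^ n ≤ r → 2 * r ≤ 32 ^ n → m (closedBall x (2 * r)) ≤
      ((D ^ 7 : ℕ) : ENNReal) ^ 6 * m (closedBall x r)) := by
  classical
  obtain ⟨A, hA⟩ := exists_netSys h (32 ^ n) (by positivity)
  let m : Measure X := Measure.sum fun z : X =>
    (if z ∈ A.N (2 * n + 1) then ENNReal.ofReal (A.w (2 * n + 1) z) else 0) • Measure.dirac z
  have hm : ∀ x r, m (closedBall x r) = A.F (2 * n + 1) (closedBall x r) := by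
    intro x r
    rw [Measure.sum_apply _ measurableSet_closedBall]
    unfold NetSys.F
    refine tsum_congr fun z => ?_
    rw [Measure.smul_apply, Measure.dirac_apply' _ measurableSet_closedBall, Set.indicator_apply]
    by_cases h1 : z ∈ A.N (2 * n + 1) <;> by_cases h2 : z ∈ closedBall x r <;> simp [h1, h2]
  have hs2 : A.s (2 * n) = 1 / 32 ^ n := by
    rw [hA, two_mul, pow_add]; field_simp
  refine ⟨m, fun x r => ?_, fun x r hr => ?_, fun x r hr hr2 => ?_⟩
  · rw [hm]; exact A.F_lt_top _ _ _
  · rw [hm]; refine A.F_pos _ _ _ ?_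
    rw [A.ssucc]; have := A.spos (2 * n); linarith
  · rw [hm, hm]
    have hr0 : 0 < r := lt_of_lt_of_le (by positivity) hr
    have hex : ∃ i, A.s i < 2 * r := ⟨2 * n, by rw [hs2]; linarith⟩
    have hf := Nat.find_spec hex
    have hle : Nat.find hex ≤ 2 * n := Nat.find_min' hex (by rw [hs2]; linarith)
    have hmin : ∀ i < Nat.find hex, ¬ A.s i < 2 * r := fun i hi => Nat.find_min hex hi
    generalize Nat.find hex = i at *
    rcases i with _ | i
    · rw [hA] at hf; simp at hf; linarith
    · obtain ⟨k, hk⟩ := Nat.exists_eq_add_of_le hle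
      have e : 2 * n + 1 = i + 2 + k := by omega
      rw [e]
      refine A.F_doubling i k x r (not_lt.1 (hmin i (Nat.lt_succ_self i))) ?_
      rw [A.ssucc] at hf
      linarith

open CompactlySupported in
noncomputable def cut {X : Type*} [MetricSpace X] [ProperSpace X] (x : X) (r : ℝ) (hr : 0 < r) :
    C_c(X, ℝ) where
  toFun y := max 0 (min 1 (2 - dist y x / r))
  continuous_toFun := by fun_prop
  hasCompactSupport' := by
    refine HasCompactSupport.intro (isCompact_closedBall x (2 * r)) fun y hy => ?_
    rw [mem_closedBall, not_le, ← lt_div_iff₀ hr] at hy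
    exact max_eq_left (min_le_of_right_le (by linarith))

theorem cut_apply {X : Type*} [MetricSpace X] [ProperSpace X] (x : X) (r : ℝ) (hr : 0 < r) (y : X) :
    cut x r hr y = max 0 (min 1 (2 - dist y x / r)) := rfl

theorem fin_ball {X : Type*} [MetricSpace X] [ProperSpace X] [MeasurableSpace X]
    (m : Measure X) [IsFiniteMeasureOnCompacts m] (x : X) (r : ℝ) : m (closedBall x r) ≠ ⊤ :=
  (isCompact_closedBall x r).measure_ne_top

theorem le_cut {X : Type*} [MetricSpace X] [ProperSpace X] [MeasurableSpace X] [BorelSpace X]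
    (m : Measure X) [IsFiniteMeasureOnCompacts m] (x : X) (r : ℝ) (hr : 0 < r) :
    m.real (closedBall x r) ≤ ∫ y, cut x r hr y ∂m := by
  rw [← integral_indicator_one measurableSet_closedBall]
  refine integral_mono ?_ (cut x r hr).integrable ?_
  · exact (integrable_indicator_iff measurableSet_closedBall).2
      (integrableOn_const (fin_ball m x r))
  · intro y
    rw [cut_apply]
    by_cases hy : y ∈ closedBall x r
    · rw [Set.indicator_of_mem hy]
      rw [mem_closedBall, ← div_le_one hr] at hy
      refine le_max_of_le_right (le_min le_rfl ?_)
      simp only [Pi.one_apply]; linarith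
    · rw [Set.indicator_of_notMem hy]; exact le_max_left _ _

theorem cut_le {X : Type*} [MetricSpace X] [ProperSpace X] [MeasurableSpace X] [BorelSpace X]
    (m : Measure X) [IsFiniteMeasureOnCompacts m] (x : X) (r : ℝ) (hr : 0 < r) :
    ∫ y, cut x r hr y ∂m ≤ m.real (closedBall x (2 * r)) := by
  rw [← integral_indicator_one measurableSet_closedBall]
  refine integral_mono (cut x r hr).integrable ?_ ?_
  · exact (integrable_indicator_iff measurableSet_closedBall).2
      (integrableOn_const (fin_ball m x (2 * r)))
  · intro y
    simp only [cut_apply]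
    by_cases hy : y ∈ closedBall x (2 * r)
    · rw [Set.indicator_of_mem hy]
      exact max_le zero_le_one (min_le_left _ _)
    · rw [Set.indicator_of_notMem hy]
      rw [mem_closedBall, not_le, ← lt_div_iff₀ hr] at hy
      exact max_le le_rfl (min_le_of_right_le (by linarith))

open CompactlySupported Filter Topology in
theorem weak_limit {X : Type*} [MetricSpace X] [ProperSpace X] [MeasurableSpace X] [BorelSpace X]
    (m : ℕ → Measure X) [∀ n, IsFiniteMeasureOnCompacts (m n)] (x0 : X)
    (hb : ∀ R : ℝ, ∃ B : ℝ, ∀ᶠ n in atTop, (m n).real (closedBall x0 R) ≤ B) :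
    ∃ (μ : Measure X) (U : Filter ℕ), IsFiniteMeasureOnCompacts μ ∧ U.NeBot ∧ U ≤ atTop ∧
      ∀ f : C_c(X, ℝ), Tendsto (fun n => ∫ y, f y ∂(m n)) U (𝓝 (∫ y, f y ∂μ)) := by
  let U : Ultrafilter ℕ := hyperfilter ℕ
  have hU : (U : Filter ℕ) ≤ atTop := Nat.hyperfilter_le_atTop
  have hlim : ∀ f : C_c(X, ℝ), ∃ L, Tendsto (fun n => ∫ y, f y ∂(m n)) U (𝓝 L) := by
    intro f
    obtain ⟨R, hR⟩ : ∃ R, tsupport f ⊆ closedBall x0 R :=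
      (f.hasCompactSupport'.isCompact.isBounded).subset_closedBall x0
    obtain ⟨B, hB⟩ := hb R
    obtain ⟨c, hc⟩ := f.hasCompactSupport'.exists_bound_of_continuous f.continuous
    have hbd : ∀ᶠ n in (U : Filter ℕ), ∫ y, f y ∂(m n) ∈ Set.Icc (-(c * B)) (c * B) := by
      refine hU (hB.mono fun n hn => ?_)
      have hc0 : 0 ≤ c := (norm_nonneg _).trans (hc x0)
      rw [← setIntegral_eq_integral_of_forall_compl_eq_zero (s := closedBall x0 R)
        (fun y hy => image_eq_zero_of_notMem_tsupport (fun h => hy (hR h)))]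
      have := norm_setIntegral_le_of_norm_le_const (μ := m n) (s := closedBall x0 R) (f := f)
        (C := c) (fin_ball _ _ _).lt_top (fun y _ => hc y)
      rw [Real.norm_eq_abs, abs_le] at this
      have h2 : c * (m n).real (closedBall x0 R) ≤ c * B := by gcongr
      exact ⟨by linarith [this.1], this.2.trans h2⟩
    obtain ⟨L, _, hL⟩ := (isCompact_Icc (a := -(c * B)) (b := c * B)).ultrafilter_le_nhds
      (U.map (fun n => ∫ y, f y ∂(m n))) (le_principal_iff.2 hbd)
    exact ⟨L, hL⟩
  choose L hL using hlim
  let Λ : C_c(X, ℝ) →ₚ[ℝ] ℝ := PositiveLinearMap.mk₀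
    { toFun := L
      map_add' := fun f g => by
        refine tendsto_nhds_unique (hL (f + g)) (((hL f).add (hL g)).congr fun n => ?_)
        exact (integral_add' f.integrable g.integrable).symm
      map_smul' := fun c f => by
        refine tendsto_nhds_unique (hL (c • f)) (((hL f).const_mul c).congr fun n => ?_)
        exact (integral_smul c f).symm }
    (fun f hf => ge_of_tendsto' (hL f) (fun n => integral_nonneg hf))
  refine ⟨RealRMK.rieszMeasure Λ, U, inferInstance, inferInstance, hU, fun f => ?_⟩
  rw [RealRMK.integral_rieszMeasure]
  exact hL f

open Filter Topology in
theorem doubling_measure {X : Type*} [MetricSpace X] [Nonempty X] [CompleteSpace X]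
    [MeasurableSpace X] [BorelSpace X] {D : ℕ} (h : MetricDoubling X D) :
    ∃ (μ : Measure X) (K : ℝ), 1 ≤ K ∧ (∀ x r, μ (closedBall x r) ≠ ⊤) ∧
      (∀ x r, 0 < r → 0 < μ.real (closedBall x r)) ∧
      ∀ x r, 0 < r → μ.real (closedBall x (2 * r)) ≤ K * μ.real (closedBall x r) := by
  have := proper h
  obtain ⟨x0⟩ := ‹Nonempty X›
  have : Nonempty X := ⟨x0⟩
  choose m' hfin hpos hdbl using stage h (X := X)
  let m : ℕ → Measure X := fun n => (m' n (closedBall x0 1))⁻¹ • m' n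
  have hp1 : ∀ n, 0 < m' n (closedBall x0 1) := fun n => hpos n x0 1 (by
    rw [div_le_one (by positivity)]; exact one_le_pow₀ (by norm_num))
  have hfin' : ∀ n x r, m n (closedBall x r) < ⊤ := by
    intro n x r
    simp only [m, Measure.smul_apply, smul_eq_mul]
    exact ENNReal.mul_lt_top (ENNReal.inv_lt_top.2 (hp1 n)) (hfin n x r)
  have : ∀ n, IsFiniteMeasureOnCompacts (m n) := by
    intro n
    refine ⟨fun K hK => ?_⟩
    obtain ⟨R, hR⟩ := hK.isBounded.subset_closedBall x0
    exact (measure_mono hR).trans_lt (hfin' n x0 R)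
  have hone : ∀ n, (m n).real (closedBall x0 1) = 1 := by
    intro n
    simp only [m, Measure.real, Measure.smul_apply, smul_eq_mul]
    rw [ENNReal.inv_mul_cancel (hp1 n).ne' (hfin n x0 1).ne]; simp
  let K : ℝ := ((D ^ 7 : ℕ) : ℝ) ^ 6
  have hK0 : 0 ≤ K := by positivity
  have hd : ∀ x r, 0 < r → ∀ᶠ n in atTop,
      (m n).real (closedBall x (2 * r)) ≤ K * (m n).real (closedBall x r) := by
    intro x r hr
    have t : Tendsto (fun n : ℕ => (32 : ℝ) ^ n) atTop atTop :=
      tendsto_pow_atTop_atTop_of_one_lt (by norm_num)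
    filter_upwards [t.eventually_ge_atTop (2 * r), t.eventually_ge_atTop (1 / r)] with n h1 h2
    have h3 := hdbl n x r (by
      rw [div_le_iff₀ (by positivity)]; rw [div_le_iff₀ hr] at h2; linarith) h1
    have h4 : m n (closedBall x (2 * r)) ≤ ((D ^ 7 : ℕ) : ENNReal) ^ 6 * m n (closedBall x r) := by
      simp only [m, Measure.smul_apply, smul_eq_mul]
      rw [mul_left_comm]
      gcongr
    have h5 := ENNReal.toReal_mono (ENNReal.mul_ne_top (by finiteness) (hfin' n x r).ne) h4
    rw [ENNReal.toReal_mul, ENNReal.toReal_pow, ENNReal.toReal_natCast] at h5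
    exact h5
  have hdk : ∀ (k : ℕ) x r, 0 < r → ∀ᶠ n in atTop,
      (m n).real (closedBall x (2 ^ k * r)) ≤ K ^ k * (m n).real (closedBall x r) := by
    intro k
    induction k with
    | zero => intro x r hr; simp
    | succ k ih =>
      intro x r hr
      filter_upwards [ih x r hr, hd x (2 ^ k * r) (by positivity)] with n h1 h2
      rw [pow_succ', mul_assoc, pow_succ', mul_assoc]
      exact h2.trans (by gcongr)
  have hmono : ∀ n x y r R, dist x y + r ≤ R →
      (m n).real (closedBall x r) ≤ (m n).real (closedBall y R) := by
    intro n x y r R hR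
    exact measureReal_mono (closedBall_subset_closedBall' (by linarith)) (hfin' n y R).ne
  obtain ⟨μ, U, hμ, hU, hUat, hlim⟩ := weak_limit m x0 (by
    intro R
    obtain ⟨k, hk⟩ := pow_unbounded_of_one_lt R (one_lt_two)
    refine ⟨K ^ k, (hdk k x0 1 one_pos).mono fun n hn => ?_⟩
    rw [hone] at hn
    refine (hmono n x0 x0 R _ ?_).trans (hn.trans_eq (mul_one _))
    rw [dist_self]; linarith)
  have hpos' : ∀ x r, 0 < r → 0 < μ.real (closedBall x r) := by
    intro x r hr
    obtain ⟨k, hk⟩ := pow_unbounded_of_one_lt ((dist x0 x + 1) / (r / 2)) (one_lt_two)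
    rw [div_lt_iff₀ (by positivity)] at hk
    have e1 : ∀ᶠ n in U, (1 : ℝ) ≤ K ^ k * ∫ y, cut x (r / 2) (by positivity) y ∂(m n) := by
      refine hUat ((hdk k x (r / 2) (by positivity)).mono fun n hn => ?_)
      rw [← hone n]
      refine (hmono n x0 x 1 _ hk.le).trans (hn.trans ?_)
      gcongr
      exact le_cut _ _ _ _
    have e2 := ge_of_tendsto ((hlim _).const_mul (K ^ k)) e1
    have e3 := cut_le μ x (r / 2) (by positivity)
    rw [mul_div_cancel₀ _ (two_ne_zero' ℝ)] at e3
    by_contra hcon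
    have : ∫ y, cut x (r / 2) (by positivity) y ∂μ ≤ 0 := e3.trans (not_lt.1 hcon)
    have := mul_nonpos_of_nonneg_of_nonpos (pow_nonneg hK0 k) this
    linarith
  have hdbl' : ∀ x r, 0 < r → μ.real (closedBall x (2 * r)) ≤ K ^ 3 * μ.real (closedBall x r) := by
    intro x r hr
    have e1 : ∀ᶠ n in U, ∫ y, cut x (2 * r) (by positivity) y ∂(m n) ≤
        K ^ 3 * ∫ y, cut x (r / 2) (by positivity) y ∂(m n) := by
      refine hUat ((hdk 3 x (r / 2) (by positivity)).mono fun n hn => ?_)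
      refine (cut_le _ _ _ _).trans ((le_of_eq ?_).trans (hn.trans ?_))
      · congr 2; ring
      · gcongr
        exact le_cut _ _ _ _
    have e2 := le_of_tendsto_of_tendsto (hlim _) ((hlim _).const_mul (K ^ 3)) e1
    have e3 := cut_le μ x (r / 2) (by positivity)
    rw [mul_div_cancel₀ _ (two_ne_zero' ℝ)] at e3
    refine (le_cut μ x (2 * r) (by positivity)).trans (e2.trans ?_)
    gcongr
  refine ⟨μ, max 1 (K ^ 3), le_max_left _ _, fun x r => fin_ball μ x r, hpos', fun x r hr => ?_⟩
  refine (hdbl' x r hr).trans ?_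
  gcongr
  exact le_max_right _ _

theorem exists_homeo (E : ℝ) (hE : 0 < E) (a : ℝ) (ha : 0 < a) (s : ℕ) (hs : 1 ≤ s) :
    ∃ η : Homeomorph (Set.Ici (0:ℝ)) (Set.Ici (0:ℝ)),
      ∀ t : Set.Ici (0:ℝ), (η t : ℝ) = E * ((t : ℝ) ^ a + (t : ℝ) ^ s) := by
  have hs0 : s ≠ 0 := by omega
  let g : ℝ → ℝ := fun t => E * (t ^ a + t ^ s)
  let f : Set.Ici (0:ℝ) → Set.Ici (0:ℝ) := fun t => ⟨E * ((t : ℝ) ^ a + (t : ℝ) ^ s), by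
    have : (0 : ℝ) ≤ t := t.2
    rw [Set.mem_Ici]; positivity⟩
  have hmono : StrictMono f := by
    intro t u htu
    have h0 : (0 : ℝ) ≤ t := t.2
    have h1 : (t : ℝ) < u := htu
    change E * ((t : ℝ) ^ a + (t : ℝ) ^ s) < E * ((u : ℝ) ^ a + (u : ℝ) ^ s)
    have := Real.rpow_lt_rpow h0 h1 ha
    have := pow_lt_pow_left₀ h1 h0 hs0
    gcongr
  have hcont : Continuous g := by
    have : Continuous fun t : ℝ => t ^ a := Real.continuous_rpow_const ha.le
    fun_prop
  have hsurj : Function.Surjective f := by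
    rintro ⟨y, hy⟩
    rw [Set.mem_Ici] at hy
    have hT : 0 ≤ max 1 (y / E) := by positivity
    have := intermediate_value_Icc hT hcont.continuousOn
    have hmem : y ∈ Set.Icc (g 0) (g (max 1 (y / E))) := by
      constructor
      · simp only [g]; rw [Real.zero_rpow ha.ne', zero_pow hs0]; simpa using hy
      · have h1 : max 1 (y / E) ≤ (max 1 (y / E)) ^ s := le_self_pow₀ (le_max_left _ _) hs0
        have h2 : y / E ≤ max 1 (y / E) := le_max_right _ _
        have h3 : 0 ≤ max 1 (y / E) ^ a := by positivity
        have h4 : y = E * (y / E) := by field_simp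
        simp only [g]
        calc y = E * (y / E) := h4
          _ ≤ _ := by gcongr; linarith
    obtain ⟨t, ht, hty⟩ := this hmem
    exact ⟨⟨t, ht.1⟩, Subtype.ext hty⟩
  exact ⟨(hmono.orderIsoOfSurjective f hsurj).toHomeomorph, fun t => rfl⟩

theorem metrize {X : Type*} (V : X → X → ℝ) (h0 : ∀ x y, 0 ≤ V x y) (hxx : ∀ x, V x x = 0)
    (hc : ∀ x y, V x y = V y x) (hz : ∀ x y, V x y = 0 → x = y) (L : ℝ) 
    (h4 : ∀ a b c d, V a d ≤ L * max (V a b) (max (V b c) (V c d))) :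
    ∃ n : ℕ, 1 ≤ n ∧ ∃ ρ : X → X → ℝ, IsMetricFun ρ ∧
      ∀ x y, ρ x y ^ n ≤ V x y ∧ V x y ≤ 2 ^ n * ρ x y ^ n := by
  obtain ⟨n', hn'⟩ := pow_unbounded_of_one_lt L (one_lt_two)
  obtain ⟨n, hn, hLn⟩ : ∃ n : ℕ, 1 ≤ n ∧ L ≤ 2 ^ n :=
    ⟨n' + 1, by omega, hn'.le.trans (pow_le_pow_right₀ one_le_two (by omega))⟩
  have hn0 : n ≠ 0 := by omega
  have hex : ∀ x y, ∃ q : NNReal, (q : ℝ) ^ n = V x y := fun x y =>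
    ⟨⟨V x y ^ (n⁻¹ : ℝ), Real.rpow_nonneg (h0 x y) _⟩, Real.rpow_inv_natCast_pow (h0 x y) hn0⟩
  choose q hq using hex
  have qs : ∀ x, q x x = 0 := by
    intro x
    have := hq x x
    rw [hxx] at this
    exact_mod_cast pow_eq_zero_iff hn0 |>.1 this
  have inj : ∀ a b : NNReal, (a : ℝ) ^ n ≤ (b : ℝ) ^ n → a ≤ b := by
    intro a b hab
    exact_mod_cast (pow_le_pow_iff_left₀ a.2 b.2 hn0).1 hab
  have qc : ∀ x y, q x y = q y x := fun x y =>
    le_antisymm (inj _ _ (by rw [hq, hq, hc])) (inj _ _ (by rw [hq, hq, hc]))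
  have q4 : ∀ x₁ x₂ x₃ x₄, q x₁ x₄ ≤ 2 * max (q x₁ x₂) (max (q x₂ x₃) (q x₃ x₄)) := by
    intro a b c d
    apply inj
    rw [hq, NNReal.coe_mul, mul_pow]
    refine (h4 a b c d).trans ?_
    have hm : max (V a b) (max (V b c) (V c d)) ≤
        ((max (q a b) (max (q b c) (q c d)) : NNReal) : ℝ) ^ n := by
      refine max_le ?_ (max_le ?_ ?_)
      · rw [← hq]; gcongr; exact le_max_left _ _
      · rw [← hq]; gcongr; exact (le_max_left _ _).trans (le_max_right _ _)
      · rw [← hq]; gcongr; exact (le_max_right _ _).trans (le_max_right _ _)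
    have hm0 : 0 ≤ max (V a b) (max (V b c) (V c d)) := le_max_of_le_left (h0 _ _)
    calc _ ≤ 2 ^ n * max (V a b) (max (V b c) (V c d)) := by gcongr
      _ ≤ _ := by simp only [NNReal.coe_ofNat]; gcongr
  let I : PseudoMetricSpace X := PseudoMetricSpace.ofPreNNDist q qs qc
  have le1 : ∀ x y, I.dist x y ≤ q x y := PseudoMetricSpace.dist_ofPreNNDist_le q qs qc
  have le2 : ∀ x y, (q x y : ℝ) ≤ 2 * I.dist x y :=
    PseudoMetricSpace.le_two_mul_dist_ofPreNNDist q qs qc q4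
  have nn : ∀ x y, 0 ≤ I.dist x y := fun x y => @dist_nonneg X I x y
  refine ⟨n, hn, I.dist, ⟨nn, fun x y => ⟨fun h => ?_, ?_⟩, I.dist_comm,
    fun x y z => I.dist_triangle x z y⟩, fun x y => ⟨?_, ?_⟩⟩
  · apply hz
    have h1 := le2 x y
    rw [h, mul_zero] at h1
    rw [← hq, le_antisymm h1 (q x y).2, zero_pow hn0]
  · rintro rfl; exact I.dist_self x
  · rw [← hq]; exact pow_le_pow_left₀ (nn x y) (le1 x y) n
  · rw [← hq, ← mul_pow]; exact pow_le_pow_left₀ (q x y).2 (le2 x y) n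

theorem root_le {y z : ℝ} {n : ℕ} (hn : n ≠ 0) (hz : 1 ≤ z) (h : y ^ n ≤ z) : y ≤ z := by
  rcases le_or_gt y 1 with h1 | h1
  · linarith
  · exact (le_self_pow₀ h1.le hn).trans h

end QSA

theorem stmt18 {X : Type*} [MetricSpace X] [Nontrivial X] [CompleteSpace X]
    [MeasurableSpace X] [BorelSpace X]
    (D₁ : ℕ) (hdbl : MetricDoubling X D₁)
    (C : ℝ) (hC : 1 ≤ C) (hup : UniformlyPerfect X C) :
    ∃ α : ℝ, 0 < α ∧ ∃ ρ : X → X → ℝ, IsMetricFun ρ ∧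
      ∃ (μ : Measure X) (C₀ : ℝ), 1 ≤ C₀ ∧
        (∀ (x : X) (R : ℝ), 0 < R →
            ENNReal.ofReal R ≤ ⨆ (u : X) (v : X), ENNReal.ofReal (ρ u v) →
            ENNReal.ofReal (R ^ α / C₀) ≤ μ {y : X | ρ x y ≤ R} ∧
              μ {y : X | ρ x y ≤ R} ≤ ENNReal.ofReal (C₀ * R ^ α)) ∧
        ∃ η : Homeomorph (Set.Ici (0:ℝ)) (Set.Ici (0:ℝ)),
          ∀ x a b : X, x ≠ a → x ≠ b → a ≠ b →
            ρ x a / ρ x b ≤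
              (η ⟨dist x a / dist x b, Set.mem_Ici.mpr (by positivity)⟩ : ℝ) := by
  obtain ⟨μ, K, hK1, hfin, hpos, hdb⟩ := QSA.doubling_measure hdbl
  let v : X → ℝ → ℝ := fun x r => μ.real (closedBall x r)
  have vnn : ∀ x r, 0 ≤ v x r := fun x r => measureReal_nonneg
  have vpos : ∀ x r, 0 < r → 0 < v x r := hpos
  have vmono : ∀ x y r R, dist x y + r ≤ R → v x r ≤ v y R := fun x y r R h =>
    measureReal_mono (closedBall_subset_closedBall' (by linarith)) (hfin y R)
  have vm : ∀ x r R, r ≤ R → v x r ≤ v x R := fun x r R h => vmono x x r R (by simpa using h)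
  have vk : ∀ (k : ℕ) x r, 0 < r → v x (2 ^ k * r) ≤ K ^ k * v x r := by
    intro k
    induction k with
    | zero => intro x r hr; simp
    | succ k ih =>
      intro x r hr
      rw [pow_succ', mul_assoc, pow_succ', mul_assoc]
      exact (hdb x _ (by positivity)).trans (by gcongr; exact ih x r hr)
  -- reverse doubling
  obtain ⟨k0, hk0⟩ := pow_unbounded_of_one_lt (16 * C) (one_lt_two)
  obtain ⟨lam, hlam⟩ : ∃ lam, lam = 8 * C := ⟨_, rfl⟩
  have hlam8 : 8 ≤ lam := by linarith
  have hlam0 : 0 < lam := by linarith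
  obtain ⟨θ, hθ⟩ : ∃ θ : ℝ, θ = 1 - (K ^ k0)⁻¹ := ⟨_, rfl⟩
  have hKk : 1 ≤ K ^ k0 := one_le_pow₀ hK1
  have hθ1 : θ < 1 := by rw [hθ]; have : 0 < (K ^ k0)⁻¹ := by positivity
                         linarith
  have hθ0 : 0 ≤ θ := by rw [hθ]; have := inv_le_one_of_one_le₀ hKk
                         linarith
  have rev : ∀ x b R, 0 < R → R ≤ dist x b → v x (R / lam) ≤ θ * v x R := by
    intro x b R hR hRb
    obtain ⟨y, hy1, hy2⟩ := hup x (R / 2) (by positivity) (by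
      refine (ENNReal.ofReal_le_ofReal (by linarith : R / 2 ≤ dist x b)).trans ?_
      rw [← edist_dist]
      exact edist_le_ediam_of_mem (Set.mem_univ _) (Set.mem_univ _))
    have e1 : R / 2 / C = 4 * (R / lam) := by rw [hlam]; field_simp; norm_num
    have hR' : 0 < R / lam := by positivity
    rw [e1] at hy1
    have hlamR : R / lam ≤ R / 8 := by gcongr
    have hdisj : Disjoint (closedBall x (R / lam)) (closedBall y (R / lam)) :=
      closedBall_disjoint_closedBall (by linarith)
    have hsum : v x (R / lam) + v y (R / lam) ≤ v x R := by
      rw [← measureReal_union hdisj measurableSet_closedBall (hfin _ _) (hfin _ _)]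
      refine measureReal_mono (Set.union_subset (closedBall_subset_closedBall (by linarith))
        (closedBall_subset_closedBall' ?_)) (hfin x R)
      rw [dist_comm]; linarith
    have hbig : v x R ≤ K ^ k0 * v y (R / lam) := by
      refine (vmono x y R _ ?_).trans (vk k0 y _ hR')
      have : 16 * C * (R / lam) ≤ 2 ^ k0 * (R / lam) := by gcongr
      have e2 : 16 * C * (R / lam) = 2 * R := by rw [hlam]; field_simp; norm_num
      linarith
    have : (K ^ k0)⁻¹ * v x R ≤ v y (R / lam) := by
      rw [inv_mul_le_iff₀ (by positivity)]; exact hbig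
    rw [hθ]; linarith
  have revk : ∀ (k : ℕ) x b, x ≠ b → v x (dist x b / lam ^ k) ≤ θ ^ k * v x (dist x b) := by
    intro k x b hxb
    have hd := dist_pos.2 hxb
    induction k with
    | zero => simp
    | succ k ih =>
      rw [pow_succ, ← div_div, pow_succ', mul_assoc]
      refine (rev x b _ (by positivity) ?_).trans (by gcongr)
      exact div_le_self hd.le (one_le_pow₀ (by linarith))
  have vsmall : ∀ x ε, 0 < ε → ∃ t, 0 < t ∧ v x t < ε := by
    intro x ε hε
    obtain ⟨b, hb⟩ := exists_ne x
    have hd := dist_pos.2 hb.symm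
    have hv := vpos x _ hd
    obtain ⟨k, hk⟩ := exists_pow_lt_of_lt_one (div_pos hε hv) hθ1
    refine ⟨dist x b / lam ^ k, by positivity, (revk k x b hb.symm).trans_lt ?_⟩
    rwa [lt_div_iff₀ hv] at hk
  have v0 : ∀ x, v x 0 = 0 := by
    intro x
    refine le_antisymm (le_of_forall_pos_le_add fun ε hε => ?_) (vnn _ _)
    obtain ⟨t, ht, hv⟩ := vsmall x ε hε
    have := vm x 0 t ht.le
    linarith
  have vk' : ∀ (k : ℕ) x r, 0 ≤ r → v x (2 ^ k * r) ≤ K ^ k * v x r := by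
    intro k x r hr
    rcases hr.lt_or_eq with h | rfl
    · exact vk k x r h
    · rw [mul_zero, v0, mul_zero]
  -- quasi-metric
  obtain ⟨V, hV⟩ : ∃ V : X → X → ℝ, V = fun x y => v x (dist x y) + v y (dist x y) := ⟨_, rfl⟩
  have Vle : ∀ x y, v x (dist x y) ≤ V x y := by
    intro x y; rw [hV]; have := vnn y (dist x y); simp only; linarith
  have Vge : ∀ x y, V x y ≤ (1 + K) * v x (dist x y) := by
    intro x y
    have h1 := vk' 1 x (dist x y) dist_nonneg
    have h2 := vmono y x (dist x y) (2 ^ 1 * dist x y) (by rw [dist_comm y x]; linarith)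
    rw [hV]; simp only
    rw [pow_one] at *
    linarith
  have hVc : ∀ x y, V x y = V y x := by
    intro x y; rw [hV]; simp only; rw [dist_comm y x, add_comm]
  have hVL : ∀ a b c d, V a d ≤ (2 * K ^ 3) * max (V a b) (max (V b c) (V c d)) := by
    intro a b c d
    have main : ∀ u w : X, dist a b ≤ dist u w → dist b c ≤ dist u w → dist c d ≤ dist u w →
        dist a u ≤ 3 * dist u w → dist d u ≤ 3 * dist u w → V a d ≤ 2 * K ^ 3 * V u w := by
      intro u w h1 h2 h3 h4 h5
      have h6 := dist_triangle4 a b c d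
      have h7 := vmono a u (dist a d) (2 ^ 3 * dist u w) (by linarith [dist_nonneg (x := u) (y := w)])
      have h8 := vmono d u (dist a d) (2 ^ 3 * dist u w) (by linarith [dist_nonneg (x := u) (y := w)])
      have h9 := vk' 3 u (dist u w) dist_nonneg
      have h10 : K ^ 3 * v u (dist u w) ≤ K ^ 3 * V u w := by gcongr; exact Vle u w
      have : V a d = v a (dist a d) + v d (dist a d) := by rw [hV]
      linarith
    have hK3 : 0 ≤ 2 * K ^ 3 := by positivity
    have t1 := dist_nonneg (x := a) (y := b)
    have t2 := dist_nonneg (x := b) (y := c)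
    have t3 := dist_nonneg (x := c) (y := d)
    have t4 := dist_triangle a b c
    have t5 := dist_triangle b c d
    have t6 := dist_triangle4 a b c d
    have c1 := dist_comm a d
    have c2 := dist_comm b d
    have c3 := dist_comm c d
    by_cases m1 : dist b c ≤ dist a b ∧ dist c d ≤ dist a b
    · refine (main a b le_rfl m1.1 m1.2 ?_ ?_).trans (by gcongr; exact le_max_left _ _)
      · rw [dist_self]; linarith
      · linarith
    by_cases m2 : dist a b ≤ dist b c ∧ dist c d ≤ dist b c
    · refine (main b c m2.1 le_rfl m2.2 ?_ ?_).trans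
        (by gcongr; exact (le_max_left _ _).trans (le_max_right _ _))
      · linarith
      · linarith
    have m3 : dist a b ≤ dist c d ∧ dist b c ≤ dist c d := by
      by_contra m3
      grind
    refine (main c d m3.1 m3.2 le_rfl ?_ ?_).trans
        (by gcongr; exact (le_max_right _ _).trans (le_max_right _ _))
    · linarith
    · linarith
  obtain ⟨n, hn, ρ, hρ, hρV⟩ := QSA.metrize V
    (fun x y => (vnn _ _).trans (Vle x y))
    (fun x => by rw [hV]; simp [v0])
    hVc
    (fun x y h => by
      by_contra hne
      have := vpos x _ (dist_pos.2 hne)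
      have := Vle x y
      linarith) (2 * K ^ 3) hVL
  have hn0 : n ≠ 0 := by omega
  have ρnn := hρ.1
  obtain ⟨C₀, hC₀⟩ : ∃ C₀ : ℝ, C₀ = 2 ^ (n + 1) + K * (1 + K) + K * 2 ^ n := ⟨_, rfl⟩
  have hCa : 2 ^ (n + 1) ≤ C₀ := by
    have : 0 ≤ K * (1 + K) + K * 2 ^ n := by positivity
    linarith
  have hCb : K * (1 + K) ≤ C₀ := by
    have : (0 : ℝ) ≤ 2 ^ (n + 1) + K * 2 ^ n := by positivity
    linarith
  have hCc : K * 2 ^ n ≤ C₀ := by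
    have : 0 ≤ 2 ^ (n + 1) + K * (1 + K) := by positivity
    linarith
  have hC1 : 1 ≤ C₀ := (one_le_pow₀ one_le_two).trans hCa
  have hC0 : 0 < C₀ := by linarith
  refine ⟨n, by exact_mod_cast hn, ρ, hρ, μ, C₀, hC1, ?_, ?_⟩
  · intro x R hR hRd
    rw [Real.rpow_natCast]
    constructor
    · obtain ⟨t, hsub, hbd⟩ : ∃ t, closedBall x t ⊆ {y : X | ρ x y ≤ R} ∧ R ^ n ≤ C₀ * v x t := by
        have hincl : ∀ t, (1 + K) * v x t ≤ R ^ n → closedBall x t ⊆ {y : X | ρ x y ≤ R} := by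
          intro t ht y hy
          rw [mem_closedBall'] at hy
          have h1 := (hρV x y).1
          have h2 := Vge x y
          have h3 : (1 + K) * v x (dist x y) ≤ (1 + K) * v x t := by
            gcongr; exact vm x _ _ hy
          exact (pow_le_pow_iff_left₀ (ρnn x y) hR.le hn0).1 (by linarith)
        obtain ⟨t0, ht0, hvt0⟩ := vsmall x (R ^ n / (1 + K)) (by positivity)
        rw [lt_div_iff₀ (by positivity)] at hvt0
        by_cases hall : ∃ k : ℕ, R ^ n < (1 + K) * v x (2 ^ k * t0)
        · have hs := Nat.find_spec hall
          have hmin : ∀ i < Nat.find hall, ¬ R ^ n < (1 + K) * v x (2 ^ i * t0) :=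
            fun i hi => Nat.find_min hall hi
          generalize Nat.find hall = k at *
          rcases k with _ | k
          · rw [pow_zero, one_mul] at hs; linarith
          · refine ⟨2 ^ k * t0, hincl _ (not_lt.1 (hmin k (Nat.lt_succ_self k))), ?_⟩
            have h1 := hdb x (2 ^ k * t0) (by positivity)
            rw [← mul_assoc, ← pow_succ'] at h1
            calc R ^ n ≤ _ := hs.le
              _ ≤ (1 + K) * (K * v x (2 ^ k * t0)) := by gcongr
              _ = (K * (1 + K)) * v x (2 ^ k * t0) := by ring
              _ ≤ _ := by gcongr
        · push Not at hall
          have hlt : ENNReal.ofReal (R / 2) < ⨆ (u : X) (v : X), ENNReal.ofReal (ρ u v) :=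
            lt_of_lt_of_le ((ENNReal.ofReal_lt_ofReal_iff hR).2 (by linarith)) hRd
          obtain ⟨u, hu⟩ := lt_iSup_iff.1 hlt
          obtain ⟨w, huw⟩ := lt_iSup_iff.1 hu
          have huw' : R / 2 < ρ u w := (ENNReal.ofReal_lt_ofReal_iff_of_nonneg (by positivity)).1 huw
          obtain ⟨k, hk⟩ := pow_unbounded_of_one_lt ((dist u x + dist w x + dist u w) / t0) (one_lt_two)
          rw [div_lt_iff₀ ht0] at hk
          refine ⟨2 ^ k * t0, hincl _ (hall k), ?_⟩
          have h1 : (R / 2) ^ n ≤ V u w :=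
            (pow_le_pow_left₀ (by positivity) huw'.le n).trans (hρV u w).1
          have h2 := vmono u x (dist u w) (2 ^ k * t0) (by linarith [dist_nonneg (x := w) (y := x)])
          have h3 := vmono w x (dist u w) (2 ^ k * t0) (by linarith [dist_nonneg (x := u) (y := x)])
          have h4 : V u w = v u (dist u w) + v w (dist u w) := by rw [hV]
          rw [div_pow, div_le_iff₀ (by positivity)] at h1
          calc R ^ n ≤ _ := h1
            _ ≤ (2 * v x (2 ^ k * t0)) * 2 ^ n := by gcongr; linarith
            _ = 2 ^ (n + 1) * v x (2 ^ k * t0) := by ring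
            _ ≤ _ := by gcongr
      refine le_trans ?_ (measure_mono hsub)
      rw [← ENNReal.ofReal_toReal (hfin x t)]
      refine ENNReal.ofReal_le_ofReal ?_
      rw [div_le_iff₀ hC0, mul_comm]; exact hbd
    · have hun : {y : X | ρ x y ≤ R} = ⋃ N : ℕ, {y : X | ρ x y ≤ R} ∩ closedBall x N := by
        rw [← Set.inter_iUnion, iUnion_closedBall_nat, Set.inter_univ]
      have hmon : Monotone fun N : ℕ => {y : X | ρ x y ≤ R} ∩ closedBall x (N : ℝ) := by
        intro N N' h
        exact Set.inter_subset_inter_right _ (closedBall_subset_closedBall (by exact_mod_cast h))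
      rw [hun, hmon.measure_iUnion]
      refine iSup_le fun N => ?_
      set T := {y : X | ρ x y ≤ R} ∩ closedBall x (N : ℝ) with hT
      obtain ⟨t, ht, hvt⟩ : ∃ t, T ⊆ closedBall x t ∧ v x t ≤ C₀ * R ^ n := by
        have hbdd : BddAbove ((fun y => dist x y) '' T) := by
          refine ⟨N, ?_⟩
          rintro _ ⟨y, hy, rfl⟩
          exact mem_closedBall'.1 hy.2
        have hsup : ∀ y ∈ T, dist x y ≤ sSup ((fun y => dist x y) '' T) := fun y hy =>
          le_csSup hbdd ⟨y, hy, rfl⟩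
        rcases le_or_gt (sSup ((fun y => dist x y) '' T)) 0 with h0 | h0
        · refine ⟨0, fun y hy => mem_closedBall'.2 ((hsup y hy).trans h0), ?_⟩
          rw [v0]; positivity
        · have hne : ((fun y => dist x y) '' T).Nonempty := by
            by_contra hcon
            rw [Set.not_nonempty_iff_eq_empty] at hcon
            rw [hcon, Real.sSup_empty] at h0
            exact lt_irrefl _ h0
          obtain ⟨_, ⟨y, hy, rfl⟩, hlt⟩ := exists_lt_of_lt_csSup hne (half_lt_self h0)
          simp only at hlt
          refine ⟨2 * dist x y, fun z hz => mem_closedBall'.2 ?_, ?_⟩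
          · have := hsup z hz; linarith
          · have h1 := hdb x (dist x y) (by linarith)
            have h2 := Vle x y
            have h3 := (hρV x y).2
            have h4 : ρ x y ^ n ≤ R ^ n := pow_le_pow_left₀ (ρnn x y) hy.1 n
            calc v x (2 * dist x y) ≤ K * v x (dist x y) := h1
              _ ≤ K * (2 ^ n * R ^ n) := by
                gcongr; exact h2.trans (h3.trans (by gcongr))
              _ = (K * 2 ^ n) * R ^ n := by ring
              _ ≤ _ := by gcongr
      refine (measure_mono ht).trans ?_
      rw [← ENNReal.ofReal_toReal (hfin x t)]
      exact ENNReal.ofReal_le_ofReal hvt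
  · -- quasisymmetry
    obtain ⟨p, hp⟩ := exists_pow_lt_of_lt_one (inv_pos.2 hlam0) hθ1
    have hp0 : p ≠ 0 := by
      rintro rfl
      have := inv_le_one_of_one_le₀ (by linarith : 1 ≤ lam)
      rw [pow_zero] at hp; linarith
    obtain ⟨s', hs'⟩ := pow_unbounded_of_one_lt K (one_lt_two)
    obtain ⟨s, hs, hKs⟩ : ∃ s : ℕ, 1 ≤ s ∧ K ≤ 2 ^ s :=
      ⟨s' + 1, by omega, hs'.le.trans (pow_le_pow_right₀ one_le_two (by omega))⟩
    obtain ⟨E0, hE0⟩ : ∃ E0 : ℝ, E0 = 2 ^ n * (1 + K) := ⟨_, rfl⟩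
    have hE01 : 1 ≤ E0 := by
      rw [hE0]; exact one_le_mul_of_one_le_of_one_le (one_le_pow₀ one_le_two) (by linarith)
    have hE0p : 1 ≤ E0 ^ p := one_le_pow₀ hE01
    obtain ⟨E, hE⟩ : ∃ E : ℝ, E = E0 ^ p * lam + E0 * K := ⟨_, rfl⟩
    have hEa : E0 ^ p * lam ≤ E := by
      have : 0 ≤ E0 * K := by positivity
      linarith
    have hEb : E0 * K ≤ E := by
      have : 0 ≤ E0 ^ p * lam := by positivity
      linarith
    have hE1' : 1 ≤ E0 ^ p * lam := one_le_mul_of_one_le_of_one_le hE0p (by linarith)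
    have hEpos : 0 < E := by linarith
    have hnp : n * p ≠ 0 := mul_ne_zero hn0 hp0
    obtain ⟨η, hη⟩ := QSA.exists_homeo E hEpos (((n * p : ℕ) : ℝ)⁻¹)
      (inv_pos.2 (Nat.cast_pos.2 (Nat.pos_of_ne_zero hnp))) s hs
    refine ⟨η, fun x a b hxa hxb hab => ?_⟩
    rw [hη]
    simp only
    have hda := dist_pos.2 hxa
    have hdb' := dist_pos.2 hxb
    have hva := vpos x _ hda
    have hvb := vpos x _ hdb'
    have hρb : 0 < ρ x b := lt_of_le_of_ne (ρnn x b) (fun h => hxb ((hρ.2.1 x b).1 h.symm))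
    obtain ⟨t, ht⟩ : ∃ t, t = dist x a / dist x b := ⟨_, rfl⟩
    have ht0 : 0 < t := by rw [ht]; positivity
    have hta : dist x a = t * dist x b := by rw [ht]; field_simp
    rw [← ht]
    have hratio0 : 0 ≤ ρ x a / ρ x b := div_nonneg (ρnn _ _) hρb.le
    have hratio : (ρ x a / ρ x b) ^ n ≤ E0 * (v x (dist x a) / v x (dist x b)) := by
      have h1 : ρ x a ^ n ≤ (1 + K) * v x (dist x a) := (hρV x a).1.trans (Vge x a)
      have h2 : v x (dist x b) ≤ 2 ^ n * ρ x b ^ n := (Vle x b).trans (hρV x b).2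
      rw [div_pow, div_le_iff₀ (by positivity), mul_div_assoc', div_mul_eq_mul_div,
        le_div_iff₀ hvb, hE0]
      calc ρ x a ^ n * v x (dist x b) ≤ ((1 + K) * v x (dist x a)) * (2 ^ n * ρ x b ^ n) := by
            gcongr
        _ = _ := by ring
    have hta0 : 0 ≤ t ^ (((n * p : ℕ) : ℝ)⁻¹) := by positivity
    rcases le_total 1 t with h1 | h1
    · obtain ⟨k, hk1, hk2⟩ := exists_nat_pow_near h1 (one_lt_two)
      have h2 : v x (dist x a) ≤ K ^ (k + 1) * v x (dist x b) := by
        refine (vm x _ _ ?_).trans (vk (k + 1) x _ hdb')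
        rw [hta]; gcongr
      have h3 : K ^ k ≤ t ^ s := by
        calc K ^ k ≤ (2 ^ s) ^ k := by gcongr
          _ = (2 ^ k) ^ s := by rw [← pow_mul, ← pow_mul, mul_comm]
          _ ≤ _ := by gcongr
      have h4 : v x (dist x a) / v x (dist x b) ≤ K * t ^ s := by
        rw [div_le_iff₀ hvb]
        refine h2.trans ?_
        rw [pow_succ']
        gcongr
      have h5 : (ρ x a / ρ x b) ^ n ≤ E0 * K * t ^ s := by
        refine hratio.trans ?_
        rw [mul_assoc]; gcongr
      have h6 := QSA.root_le hn0 (one_le_mul_of_one_le_of_one_le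
        (one_le_mul_of_one_le_of_one_le hE01 hK1) (one_le_pow₀ h1)) h5
      refine h6.trans ?_
      have : 0 ≤ t ^ s := by positivity
      calc E0 * K * t ^ s ≤ E * t ^ s := by gcongr
        _ ≤ _ := by gcongr; linarith
    · obtain ⟨k, hk1, hk2⟩ := exists_nat_pow_near (one_le_inv_iff₀.2 ⟨ht0, h1⟩)
        (by linarith : 1 < lam)
      have h2 : v x (dist x a) ≤ θ ^ k * v x (dist x b) := by
        refine (vm x _ _ ?_).trans (revk k x b hxb)
        rw [hta, le_div_iff₀ (by positivity), mul_right_comm]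
        refine mul_le_of_le_one_left hdb'.le ?_
        rw [le_inv_comm₀ (by positivity) ht0] at hk1
        calc t * lam ^ k ≤ (lam ^ k)⁻¹ * lam ^ k := by gcongr
          _ = 1 := inv_mul_cancel₀ (by positivity)
      have h3 : (v x (dist x a) / v x (dist x b)) ^ p ≤ lam * t := by
        have h4 : v x (dist x a) / v x (dist x b) ≤ θ ^ k := (div_le_iff₀ hvb).2 h2
        calc (v x (dist x a) / v x (dist x b)) ^ p ≤ (θ ^ k) ^ p := by gcongr
          _ = (θ ^ p) ^ k := by rw [← pow_mul, ← pow_mul, mul_comm]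
          _ ≤ (lam⁻¹) ^ k := by gcongr
          _ = (lam ^ k)⁻¹ := by rw [inv_pow]
          _ ≤ lam * t := by
            rw [inv_le_iff_one_le_mul₀ (by positivity)]
            rw [inv_lt_iff_one_lt_mul₀ ht0, pow_succ] at hk2
            linarith
      have h5 : (ρ x a / ρ x b) ^ (n * p) ≤ (E0 ^ p * lam) * t := by
        rw [pow_mul]
        calc _ ≤ (E0 * (v x (dist x a) / v x (dist x b))) ^ p := by gcongr
          _ = E0 ^ p * (v x (dist x a) / v x (dist x b)) ^ p := by rw [mul_pow]
          _ ≤ E0 ^ p * (lam * t) := by gcongr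
          _ = _ := by ring
      have h6 : ρ x a / ρ x b ≤ (E0 ^ p * lam) * t ^ (((n * p : ℕ) : ℝ)⁻¹) := by
        refine (pow_le_pow_iff_left₀ hratio0 (by positivity) hnp).1 ?_
        rw [mul_pow, Real.rpow_inv_natCast_pow ht0.le hnp]
        refine h5.trans ?_
        gcongr
        exact le_self_pow₀ hE1' hnp
      refine h6.trans ?_
      have : 0 ≤ t ^ s := by positivity
      calc _ ≤ E * t ^ (((n * p : ℕ) : ℝ)⁻¹) := by gcongr
        _ ≤ _ := by gcongr; linarith
end
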